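/- arXiv:1907.12312 — 2 statements merged into one kernel-verified Lean document; each statement's English description precedes it below -/
import Mathlib

section
/- Let Q ⊂ ℝ^2 be a two-dimensional lattice polytope and let P ⊂ ℝ^2 be a lattice polytope that is a weak Minkowski summand of Q. Let p = [p1,p2] ⊆ P and q = [q1,q2] ⊆ Q be two primitive lattice segments that are not parallel, and let L_p and L_q denote the linear spans of p2−p1 and q2−q1. If the parallelogram p + q is not unimodular (i.e., p2−p1 and q2−q1 do not form a ℤ-basis of ℤ^2), then at least one of the two sets ((p1,p2) + L_q) ∩ P and ((q1,q2) + L_p) ∩ Q contains a point of ℤ^2, where (a,b) denotes the open segment with endpoints a and b. -/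
open scoped Pointwise

noncomputable section

/-- The real point corresponding to an integer point of `ℤ²`. -/
def toR2 (v : Fin 2 → ℤ) : Fin 2 → ℝ := fun i => (v i : ℝ)

/-- A lattice polytope in `ℝ²`: the convex hull of a nonempty finite set of
lattice points. -/
def IsLatticePolytope2 (P : Set (Fin 2 → ℝ)) : Prop :=
  ∃ V : Finset (Fin 2 → ℤ), V.Nonempty ∧ P = convexHull ℝ (toR2 '' ↑V)

/-- A (not necessarily lattice) polytope in `ℝ²`. -/
def IsPolytope2 (P : Set (Fin 2 → ℝ)) : Prop :=
  ∃ V : Finset (Fin 2 → ℝ), V.Nonempty ∧ P = convexHull ℝ ↑V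

/-- `P` is a weak Minkowski summand of `Q`: there are a polytope `P'` and a real
`k > 0` with `P + P' = kQ`. -/
def IsWeakMinkowskiSummand (P Q : Set (Fin 2 → ℝ)) : Prop :=
  ∃ P' : Set (Fin 2 → ℝ), IsPolytope2 P' ∧ ∃ k : ℝ, 0 < k ∧ P + P' = k • Q

/-- A primitive lattice vector in `ℤ²`: its coordinates have gcd `1`. -/
def IsPrimitive2 (d : Fin 2 → ℤ) : Prop := Int.gcd (d 0) (d 1) = 1

/-- The line spanned by a vector, as a subset of `ℝ²`. -/
def lineSpanned (d : Fin 2 → ℝ) : Set (Fin 2 → ℝ) :=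
  Set.range fun t : ℝ => t • d

theorem aux_arith (D : ℤ) (hD : 2 ≤ D) (L : ℤ → ℤ → Prop)
    (hsub : ∀ i j i' j' k l : ℤ, L i j → i' = i - k * D → j' = j - l * D → L i' j')
    (h0 : ∀ j, L 0 j → D ∣ j) (h0' : ∀ i, L i 0 → D ∣ i)
    (m n : ℝ) (hm1 : m < 1) (hn1 : n < 1)
    (hm : ∀ i j, L i j → 0 < i → i < D → 0 ≤ j → m * i < j)
    (hn : ∀ i j, L i j → 0 < j → j < D → 0 ≤ i → n * j < i)
    (i j : ℤ) (hL : L i j) (hi : D ≤ i) (hj0 : 0 < j) (hj : (j : ℝ) = m * i)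
    (hnj : (i : ℝ) - D < n * j) : False := by
  have hjR : (0:ℝ) < j := by exact_mod_cast hj0
  have hiR : (D:ℝ) ≤ i := by exact_mod_cast hi
  have hDR : (2:ℝ) ≤ D := by exact_mod_cast hD
  have e1 : i - D < j := by
    have : (i:ℝ) - D < j := by nlinarith
    exact_mod_cast this
  have e2 : j < i := by
    have : (j:ℝ) < i := by nlinarith
    exact_mod_cast this
  obtain ⟨r, i', hri, hi'0, hi'D⟩ : ∃ r i', i = r * D + i' ∧ 0 ≤ i' ∧ i' < D :=
    ⟨i / D, i % D, by rw [mul_comm]; exact (Int.mul_ediv_add_emod i D).symm,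
      Int.emod_nonneg _ (by omega), Int.emod_lt_of_pos _ (by omega)⟩
  obtain ⟨s, j', hsj, hj'0, hj'D⟩ : ∃ r i', j = r * D + i' ∧ 0 ≤ i' ∧ i' < D :=
    ⟨j / D, j % D, by rw [mul_comm]; exact (Int.mul_ediv_add_emod j D).symm,
      Int.emod_nonneg _ (by omega), Int.emod_lt_of_pos _ (by omega)⟩
  have hL' : L i' j' := hsub i j i' j' r s hL (by linarith) (by linarith)
  have hr1 : 1 ≤ r := by
    by_contra h
    have : r ≤ 0 := by omega
    nlinarith
  have hs0 : 0 ≤ s := by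
    by_contra h
    have : s ≤ -1 := by omega
    nlinarith
  have hzz : ¬ (i' = 0 ∧ j' = 0) := by
    rintro ⟨rfl, rfl⟩
    have h1 : s < r := by nlinarith
    have h2 : r - 1 < s := by nlinarith
    omega
  have hi'p : 0 < i' := by
    rcases hi'0.lt_or_eq with h | h
    · exact h
    · subst h
      exact absurd ⟨rfl, Int.eq_zero_of_dvd_of_nonneg_of_lt hj'0 hj'D (h0 _ hL')⟩ hzz
  have hj'p : 0 < j' := by
    rcases hj'0.lt_or_eq with h | h
    · exact h
    · subst h
      exact absurd ⟨Int.eq_zero_of_dvd_of_nonneg_of_lt hi'0 hi'D (h0' _ hL'), rfl⟩ hzz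
  have A := hm i' j' hL' hi'p hi'D hj'0
  have B := hn i' j' hL' hj'p hj'D hi'0
  have hriR : (i:ℝ) = r * D + i' := by exact_mod_cast hri
  have hsjR : (j:ℝ) = s * D + j' := by exact_mod_cast hsj
  have hs0R : (0:ℝ) ≤ s := by exact_mod_cast hs0
  have hr1R : (1:ℝ) ≤ r := by exact_mod_cast hr1
  have c1 : (r:ℝ) - 1 < n * s := by
    rw [hriR, hsjR] at hnj
    have : ((r:ℝ) - 1) * D < (n * s) * D := by nlinarith
    exact lt_of_mul_lt_mul_right this (by linarith)
  have c2 : r ≤ s := by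
    have h1 : n * s ≤ s := by nlinarith
    have : ((r - 1 : ℤ):ℝ) < s := by push_cast; linarith
    have : r - 1 < s := by exact_mod_cast this
    omega
  have c3 : s ≤ r := by
    by_contra h
    have : r + 1 ≤ s := by omega
    nlinarith
  have c4 : s = r := le_antisymm c3 c2
  subst c4
  rw [hriR, hsjR] at hj
  have : (s:ℝ) * D < m * (s * D) := by nlinarith
  have : (0:ℝ) < s * D := by positivity
  nlinarith

theorem aux_slope (D : ℤ) (hD : 2 ≤ D) (L : ℤ → ℤ → Prop)
    (hsub : ∀ i j i' j' k l : ℤ, L i j → i' = i - k * D → j' = j - l * D → L i' j')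
    (h0' : ∀ i, L i 0 → D ∣ i) (hex : ∀ i, ∃ j, L i j) (i : ℤ) (hi : 0 < i) (hiD : i < D) :
    ∃ j, L i j ∧ 1 ≤ j ∧ j ≤ D - 1 := by
  obtain ⟨j, hj⟩ := hex i
  have h1 : L i (j % D) := hsub i j i _ 0 (j / D) hj (by ring) (by
    have := Int.mul_ediv_add_emod j D; linarith)
  have h2 := Int.emod_nonneg j (show D ≠ 0 by omega)
  have h3 := Int.emod_lt_of_pos j (show 0 < D by omega)
  refine ⟨_, h1, ?_, by omega⟩
  by_contra h
  have h4 : j % D = 0 := by omega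
  rw [h4] at h1
  have := Int.le_of_dvd hi (h0' _ h1)
  omega

theorem aux_slope2 (D : ℤ) (hD : 2 ≤ D) (L : ℤ → ℤ → Prop)
    (hsub : ∀ i j i' j' k l : ℤ, L i j → i' = i - k * D → j' = j - l * D → L i' j')
    (h0' : ∀ i, L i 0 → D ∣ i) (hex : ∀ i, ∃ j, L i j)
    (a m : ℝ) (ha : 0 ≤ a) (ham : 0 ≤ a + m * D)
    (hm : ∀ i j, L i j → 0 < i → i < D → 0 ≤ j → a + m * i < j) :
    m < 1 ∧ -1 < m ∧ a < D := by
  have hDR : (2:ℝ) ≤ D := by exact_mod_cast hD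
  obtain ⟨j, hj, hj1, hj2⟩ := aux_slope D hD L hsub h0' hex (D-1) (by omega) (by omega)
  obtain ⟨l, hl, hl1, hl2⟩ := aux_slope D hD L hsub h0' hex 1 (by omega) (by omega)
  have A := hm _ _ hj (by omega) (by omega) (by omega)
  have B := hm _ _ hl (by omega) (by omega) (by omega)
  have hj2R : (j:ℝ) ≤ D - 1 := by exact_mod_cast hj2
  have hl2R : (l:ℝ) ≤ D - 1 := by exact_mod_cast hl2
  push_cast at A B
  have m1 : m < 1 := by
    by_contra h
    push Not at h
    nlinarith
  have m2 : -1 < m := by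
    by_contra h
    push Not at h
    nlinarith
  exact ⟨m1, m2, by linarith⟩

theorem aux_top_pos (D : ℤ) (hD : 2 ≤ D) (L : ℤ → ℤ → Prop)
    (hsub : ∀ i j i' j' k l : ℤ, L i j → i' = i - k * D → j' = j - l * D → L i' j')
    (hneg : ∀ i j, L i j → L (-i) (-j))
    (h0 : ∀ j, L 0 j → D ∣ j) (h0' : ∀ i, L i 0 → D ∣ i)
    (hex : ∀ i, ∃ j, L i j) (hex' : ∀ j, ∃ i, L i j)
    (a m b n b' n' : ℝ) (hm0 : 0 ≤ m)
    (ha : 0 ≤ a) (ham : 0 ≤ a + m * D)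
    (hm : ∀ i j, L i j → 0 < i → i < D → 0 ≤ j → a + m * i < j)
    (hb : 0 ≤ b) (hbn : 0 ≤ b + n * D)
    (hn : ∀ i j, L i j → 0 < j → j < D → 0 ≤ i → b + n * j < i)
    (hb' : b' ≤ 0) (hbn' : b' + n' * D ≤ 0)
    (hn' : ∀ i j, L i j → 0 < j → j < D → i ≤ 0 → i < b' + n' * j)
    (x y i j : ℤ) (hL : L i j) (hi : D ≤ i) (hj : (j:ℝ) = m * i)
    (hy : y ≤ 0 ∨ D ≤ y) (hgD : D ≤ y - m * x)
    (hx1 : b' + n' * y ≤ x) (hx2 : (x + i : ℝ) ≤ b + n * (y + j)) :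
    ∃ z : ℝ, D ≤ z ∧ D ≤ b + n * z - (b' + n' * z) := by
  have hDR : (2:ℝ) ≤ D := by exact_mod_cast hD
  have hiR : (D:ℝ) ≤ i := by exact_mod_cast hi
  obtain ⟨hm1, -, -⟩ := aux_slope2 D hD L hsub h0' hex a m ha ham hm
  obtain ⟨hn1, hn2, hbD⟩ := aux_slope2 D hD (fun i j => L j i)
    (fun i j i' j' k l h h1 h2 => hsub j i j' i' l k h h2 h1) h0 hex' b n hb hbn
    (fun i j h => hn j i h)
  obtain ⟨hn1', hn2', hbD'⟩ := aux_slope2 D hD (fun i j => L (-j) i)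
    (fun i j i' j' k l h h1 h2 => hsub (-j) i (-j') i' (-l) k h (by rw [h2]; ring) h1)
    (fun i h => h0 i (by simpa using h))
    (fun j => by obtain ⟨i, h⟩ := hex' j; exact ⟨-i, by simpa using h⟩) (-b') (-n')
    (by linarith) (by linarith)
    (fun i j h h1 h2 h3 => by
      have := hn' (-j) i h h1 h2 (by omega)
      push_cast at this; linarith)
  have hyD : D ≤ y := by
    rcases hy with hy | hy
    · exfalso
      have hyR : (y:ℝ) ≤ 0 := by exact_mod_cast hy
      have hxl : -(D - y : ℝ) ≤ x := by nlinarith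
      have : m * x ≥ -(m * (D - y)) := by nlinarith
      have hpos : (0:ℝ) < D - y := by linarith
      nlinarith
    · exact hy
  by_contra hcon
  push Not at hcon
  have hW := hcon y (by exact_mod_cast hyD)
  have hnj : (i:ℝ) - D < n * j := by linarith
  rcases hm0.lt_or_eq with h | h
  · have hj0 : (0:ℝ) < j := by rw [hj]; apply mul_pos h; linarith
    exact aux_arith D hD L hsub h0 h0' m n hm1 hn1
      (fun i j h h1 h2 h3 => by have := hm i j h h1 h2 h3; linarith)
      (fun i j h h1 h2 h3 => by have := hn i j h h1 h2 h3; linarith)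
      i j hL hi (by exact_mod_cast hj0) hj hnj
  · rw [← h] at hj
    rw [hj] at hnj
    linarith

theorem aux_top (D : ℤ) (hD : 2 ≤ D) (L : ℤ → ℤ → Prop)
    (hsub : ∀ i j i' j' k l : ℤ, L i j → i' = i - k * D → j' = j - l * D → L i' j')
    (hneg : ∀ i j, L i j → L (-i) (-j))
    (h0 : ∀ j, L 0 j → D ∣ j) (h0' : ∀ i, L i 0 → D ∣ i)
    (hex : ∀ i, ∃ j, L i j) (hex' : ∀ j, ∃ i, L i j)
    (a m b n b' n' : ℝ)
    (ha : 0 ≤ a) (ham : 0 ≤ a + m * D)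
    (hm : ∀ i j, L i j → 0 < i → i < D → 0 ≤ j → a + m * i < j)
    (hb : 0 ≤ b) (hbn : 0 ≤ b + n * D)
    (hn : ∀ i j, L i j → 0 < j → j < D → 0 ≤ i → b + n * j < i)
    (hb' : b' ≤ 0) (hbn' : b' + n' * D ≤ 0)
    (hn' : ∀ i j, L i j → 0 < j → j < D → i ≤ 0 → i < b' + n' * j)
    (x y i j : ℤ) (hL : L i j) (hi : D ≤ i) (hj : (j:ℝ) = m * i)
    (hy : y ≤ 0 ∨ D ≤ y) (hyj : y + j ≤ 0 ∨ D ≤ y + j) (hgD : D ≤ y - m * x)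
    (hx1 : b' + n' * y ≤ x) (hx1' : (x : ℝ) ≤ b + n * y)
    (hx2 : (x + i : ℝ) ≤ b + n * (y + j)) (hx2' : b' + n' * (y + j) ≤ (x + i : ℝ)) :
    ∃ z : ℝ, D ≤ z ∧ D ≤ b + n * z - (b' + n' * z) := by
  rcases le_total 0 m with h | h
  · exact aux_top_pos D hD L hsub hneg h0 h0' hex hex' a m b n b' n' h ha ham hm hb hbn hn
      hb' hbn' hn' x y i j hL hi hj hy hgD hx1 hx2
  · obtain ⟨z, hz, hz'⟩ := aux_top_pos D hD (fun i j => L (-i) j)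
      (fun i j i' j' k l h h1 h2 => hsub (-i) j (-i') j' (-k) l h (by rw [h1]; ring) h2)
      (fun i j h => hneg _ _ h) (fun j h => h0 j (by simpa using h))
      (fun i h => by simpa using h0' _ h) (fun i => hex (-i))
      (fun j => by obtain ⟨i, h⟩ := hex' j; exact ⟨-i, by simpa using h⟩)
      (a + m * D) (-m) (-b') (-n') (-b) (-n) (by linarith) ham (by linarith)
      (fun i j h h1 h2 h3 => by
        have := hm (D - i) j (hsub _ _ _ _ (-1) 0 h (by ring) (by ring)) (by omega) (by omega) h3
        push_cast at this; linarith)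
      (by linarith) (by linarith)
      (fun i j h h1 h2 h3 => by
        have := hn' (-i) j h h1 h2 (by omega)
        push_cast at this; linarith)
      (by linarith) (by linarith)
      (fun i j h h1 h2 h3 => by
        have := hn (-i) j h h1 h2 (by omega)
        push_cast at this; linarith)
      (-(x + i)) (y + j) i (-j) (by simpa using hneg _ _ hL) hi (by push_cast; linarith)
      hyj (by push_cast; linarith) (by push_cast; linarith) (by push_cast; linarith)
    exact ⟨z, hz, by linarith⟩

theorem aux_hull_le {E : Type*} [AddCommGroup E] [Module ℝ E] (S : Set E) (l : E →ₗ[ℝ] ℝ) (M : ℝ)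
    (h : ∀ v ∈ S, l v ≤ M) : ∀ z ∈ convexHull ℝ S, l z ≤ M := by
  have : convexHull ℝ S ⊆ {z | l z ≤ M} :=
    convexHull_min h (convex_halfSpace_le l.isLinear M)
  exact fun z hz => this hz

theorem aux_edge {E : Type*} [AddCommGroup E] [Module ℝ E] (V : Finset E) (x y : E →ₗ[ℝ] ℝ)
    (c D : ℝ) (hD : 0 < D) (hV : ∀ v ∈ V, x v ≤ c ∨ c + D ≤ x v)
    (hl : ∃ v ∈ V, x v ≤ c) (hr : ∃ v ∈ V, c + D ≤ x v) :
    ∃ A ∈ V, ∃ B ∈ V, ∃ m : ℝ, x A ≤ c ∧ c + D ≤ x B ∧ y B = y A + m * (x B - x A) ∧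
      ∀ v ∈ V, y v ≤ y A + m * (x v - x A) := by
  classical
  obtain ⟨A0, hA0, hA0'⟩ := hl
  obtain ⟨B0, hB0, hB0'⟩ := hr
  let S : Finset (E × E) := (V ×ˢ V).filter (fun q => x q.1 ≤ c ∧ c + D ≤ x q.2)
  have hS : S.Nonempty := ⟨(A0, B0), by simp [S, *]⟩
  let sl : E × E → ℝ := fun q => (y q.2 - y q.1) / (x q.2 - x q.1)
  let e : ℝ := c + D / 2
  obtain ⟨⟨A, B⟩, hAB, hmax⟩ := S.exists_max_image (fun q => y q.1 + sl q * (e - x q.1)) hS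
  simp only [S, Finset.mem_filter, Finset.mem_product] at hAB hmax
  obtain ⟨⟨hA, hB⟩, hA', hB'⟩ := hAB
  have hslE : ∀ A B : E, x A ≤ c → c + D ≤ x B → y B = y A + sl (A, B) * (x B - x A) := by
    intro A B h1 h2
    have : x B - x A ≠ 0 := by intro h; linarith
    simp only [sl]
    field_simp
    ring
  have hAB' := hslE A B hA' hB'
  refine ⟨A, hA, B, hB, sl (A, B), hA', hB', hAB', ?_⟩
  intro v hv
  set m := sl (A, B) with hm
  rcases hV v hv with h | h
  · have h1 := hmax (v, B) ⟨⟨hv, hB⟩, h, hB'⟩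
    have h2 := hslE v B h hB'
    simp only at h1
    set k := sl (v, B)
    -- at e: y B + k (e - xB) ≤ y B + m (e - x B), so k ≥ m
    have hk : m ≤ k := by
      by_contra hc
      push Not at hc
      have : 0 < (m - k) * (x B - e) := mul_pos (by linarith) (by simp only [e]; linarith)
      nlinarith
    have : 0 ≤ (k - m) * (x B - x v) := mul_nonneg (by linarith) (by linarith)
    nlinarith
  · have h1 := hmax (A, v) ⟨⟨hA, hv⟩, hA', h⟩
    have h2 := hslE A v hA' h
    simp only at h1
    set k := sl (A, v)
    have hk : k ≤ m := by
      by_contra hc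
      push Not at hc
      have : 0 < (k - m) * (e - x A) := mul_pos (by linarith) (by simp only [e]; linarith)
      nlinarith
    have : 0 ≤ (m - k) * (x v - x A) := mul_nonneg (by linarith) (by linarith)
    nlinarith

theorem aux_strip {E : Type*} [AddCommGroup E] [Module ℝ E] (V : Finset E) (x y : E →ₗ[ℝ] ℝ)
    (hinj : ∀ a b : E, x a = x b → y a = y b → a = b)
    (D : ℝ) (hD : 0 < D) (p q : E) (hp : p ∈ convexHull ℝ (V : Set E))
    (hq : q ∈ convexHull ℝ (V : Set E)) (hx : x q = x p + D) (hy : y q = y p)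
    (hV : ∀ v ∈ V, x v ≤ x p ∨ x p + D ≤ x v) :
    ∃ A ∈ V, ∃ B ∈ V, ∃ a m : ℝ, x A ≤ x p ∧ x p + D ≤ x B ∧
      y A - y p = a + m * (x A - x p) ∧ y B - y p = a + m * (x B - x p) ∧
      0 ≤ a ∧ 0 ≤ a + m * D ∧
      (∀ z ∈ convexHull ℝ (V : Set E), y z - y p ≤ a + m * (x z - x p)) ∧
      (∀ z, x p < x z → x z < x p + D → y p ≤ y z → y z - y p ≤ a + m * (x z - x p) →
        z ∈ convexHull ℝ (V : Set E)) := by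
  have hl : ∃ v ∈ V, x v ≤ x p := by
    by_contra hc
    push Not at hc
    have := aux_hull_le (V : Set E) (-x) (-(x p + D)) (fun v hv => by
      rcases hV v hv with h | h
      · exact absurd h (not_le.2 (hc v hv))
      · simpa using by linarith) p hp
    simp at this
    linarith
  have hr : ∃ v ∈ V, x p + D ≤ x v := by
    by_contra hc
    push Not at hc
    have := aux_hull_le (V : Set E) x (x p) (fun v hv => by
      rcases hV v hv with h | h
      · exact h
      · exact absurd h (not_le.2 (hc v hv))) q hq
    linarith
  obtain ⟨A, hA, B, hB, m, hA', hB', hAB, hle⟩ := aux_edge V x y (x p) D hD hV hl hr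
  have hle' : ∀ z ∈ convexHull ℝ (V : Set E), y z ≤ y A + m * (x z - x A) := by
    intro z hz
    have := aux_hull_le (V : Set E) (y - m • x) (y A - m * x A) (fun v hv => by
      have := hle v hv
      simp
      linarith) z hz
    simp at this
    linarith
  refine ⟨A, hA, B, hB, y A - y p + m * (x p - x A), m, hA', hB', by ring, by rw [hAB]; ring,
    ?_, ?_, ?_, ?_⟩
  · have := hle' p hp; linarith
  · have := hle' q hq; rw [hx, hy] at this; linarith
  · intro z hz
    have := hle' z hz; linarith
  · intro z h1 h2 h3 h4
    have hconv := convex_convexHull ℝ (V : Set E)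
    -- point on the base
    have hz0 : (1 - (x z - x p) / D) • p + ((x z - x p) / D) • q ∈ convexHull ℝ (V : Set E) :=
      hconv hp hq (by rw [sub_nonneg, div_le_one hD]; linarith)
        (div_nonneg (by linarith) hD.le) (by ring)
    have hBA : 0 < x B - x A := by linarith
    have hz1 : (1 - (x z - x A) / (x B - x A)) • A + ((x z - x A) / (x B - x A)) • B
        ∈ convexHull ℝ (V : Set E) :=
      hconv (subset_convexHull ℝ _ hA) (subset_convexHull ℝ _ hB)
        (by rw [sub_nonneg, div_le_one hBA]; linarith)
        (div_nonneg (by linarith) hBA.le) (by ring)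
    set z0 := (1 - (x z - x p) / D) • p + ((x z - x p) / D) • q with hz0d
    set z1 := (1 - (x z - x A) / (x B - x A)) • A + ((x z - x A) / (x B - x A)) • B with hz1d
    have e0 : x z0 = x z := by
      simp only [hz0d, map_add, map_smul, smul_eq_mul, hx]; field_simp; ring
    have e0' : y z0 = y p := by
      simp only [hz0d, map_add, map_smul, smul_eq_mul, hy]; ring
    have e1 : x z1 = x z := by
      simp only [hz1d, map_add, map_smul, smul_eq_mul]; field_simp; ring
    have e1' : y z1 = y A + m * (x z - x A) := by
      simp only [hz1d, map_add, map_smul, smul_eq_mul, hAB]; field_simp; ring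
    have h5 : y z ≤ y z1 := by rw [e1']; linarith
    rcases (h3.trans h5).lt_or_eq with h6 | h6
    · have h7 : 0 < y z1 - y p := by linarith
      have := hconv hz0 hz1 (a := 1 - (y z - y p) / (y z1 - y p)) (b := (y z - y p) / (y z1 - y p))
        (by rw [sub_nonneg, div_le_one h7]; linarith)
        (div_nonneg (by linarith) h7.le) (by ring)
      convert this using 1
      apply hinj
      · simp only [map_add, map_smul, smul_eq_mul, e0, e1]; ring
      · simp only [map_add, map_smul, smul_eq_mul, e0']; field_simp; ring
    · convert hz0 using 1
      apply hinj
      · exact e0.symm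
      · rw [e0']; linarith

theorem aux_face_unique {E : Type*} [AddCommGroup E] [Module ℝ E] (V : Finset E) (l : E →ₗ[ℝ] ℝ)
    (g : E) (hu : ∀ v ∈ V, v ≠ g → l v < l g) (z : E)
    (hz : z ∈ convexHull ℝ (V : Set E)) (hlz : l g ≤ l z) : z = g := by
  rw [Finset.mem_convexHull'] at hz
  obtain ⟨w, hw0, hw1, hwz⟩ := hz
  have hsum : ∑ v ∈ V, w v * (l g - l v) ≤ 0 := by
    have : l z = ∑ v ∈ V, w v * l v := by rw [← hwz]; simp
    simp only [mul_sub, Finset.sum_sub_distrib, ← Finset.sum_mul, hw1]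
    linarith
  have hnn : ∀ v ∈ V, 0 ≤ w v * (l g - l v) := by
    intro v hv
    by_cases h : v = g
    · simp [h]
    · exact mul_nonneg (hw0 v hv) (by linarith [hu v hv h])
  have h0 := (Finset.sum_eq_zero_iff_of_nonneg hnn).1 (le_antisymm hsum (Finset.sum_nonneg hnn))
  rw [← hwz]
  calc ∑ v ∈ V, w v • v = ∑ v ∈ V, w v • g := by
        apply Finset.sum_congr rfl
        intro v hv
        by_cases h : v = g
        · rw [h]
        · have := h0 v hv
          have h' := hu v hv h
          rcases mul_eq_zero.1 this with h1 | h1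
          · simp [h1]
          · linarith
    _ = g := by rw [← Finset.sum_smul, hw1, one_smul]

theorem aux_face (P Q : Set (Fin 2 → ℝ)) (V : Finset (Fin 2 → ℝ)) (hV : V.Nonempty)
    (hQ : Q = convexHull ℝ (V : Set (Fin 2 → ℝ)))
    (hPQ : IsWeakMinkowskiSummand P Q) (l : (Fin 2 → ℝ) →ₗ[ℝ] ℝ)
    (A B : Fin 2 → ℝ) (hA : A ∈ P) (hB : B ∈ P) (hne : A ≠ B) (hAB : l B = l A)
    (hmax : ∀ z ∈ P, l z ≤ l A) :
    ∃ g ∈ V, ∃ g' ∈ V, g ≠ g' ∧ l g = l g' ∧ ∀ z ∈ Q, l z ≤ l g := by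
  obtain ⟨P', ⟨V', hV', rfl⟩, k, hk, hsum⟩ := hPQ
  obtain ⟨c, hc, hcmax⟩ := V'.exists_max_image l hV'
  have hc' := subset_convexHull ℝ (V' : Set (Fin 2 → ℝ)) hc
  have hcm := aux_hull_le (V' : Set (Fin 2 → ℝ)) l (l c) hcmax
  obtain ⟨g, hg, hgmax⟩ := V.exists_max_image l hV
  have hgm : ∀ z ∈ Q, l z ≤ l g := by
    rw [hQ]; exact aux_hull_le (V : Set (Fin 2 → ℝ)) l (l g) hgmax
  have hgQ : g ∈ Q := by rw [hQ]; exact subset_convexHull ℝ _ hg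
  have hAc : A + c ∈ k • Q := by rw [← hsum]; exact Set.add_mem_add hA hc'
  have hBc : B + c ∈ k • Q := by rw [← hsum]; exact Set.add_mem_add hB hc'
  obtain ⟨G1, hG1, hG1e⟩ := hAc
  obtain ⟨G2, hG2, hG2e⟩ := hBc
  simp only at hG1e hG2e
  have hkg : k • g ∈ P + convexHull ℝ (V' : Set (Fin 2 → ℝ)) := by
    rw [hsum]; exact Set.smul_mem_smul_set hgQ
  obtain ⟨r, hr, s, hs, hrs⟩ := hkg
  have h1 : k * l g ≤ l A + l c := by
    have : k * l g = l r + l s := by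
      have := congrArg l hrs
      simp at this; linarith
    have := hmax r hr
    have := hcm s hs
    linarith
  have h2 : k * l G1 = l A + l c := by
    have := congrArg l hG1e
    simpa using this
  have h3 : k * l G2 = l A + l c := by
    have := congrArg l hG2e
    simp at this; linarith
  by_contra hcon
  have hu : ∀ v ∈ V, v ≠ g → l v < l g := by
    intro v hv hvg
    rcases (hgmax v hv).lt_or_eq with h | h
    · exact h
    · exact absurd ⟨g, hg, v, hv, hvg.symm, h.symm, hgm⟩ hcon
  have e1 := aux_face_unique V l g hu G1 (hQ ▸ hG1) (le_of_mul_le_mul_left (by linarith) hk)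
  have e2 := aux_face_unique V l g hu G2 (hQ ▸ hG2) (le_of_mul_le_mul_left (by linarith) hk)
  apply hne
  rw [e1] at hG1e
  rw [e2, hG1e] at hG2e
  exact add_right_cancel hG2e

theorem aux_prim (d e : Fin 2 → ℤ) (hd : d ≠ 0) (hde : d 0 * e 1 = d 1 * e 0) :
    ∃ (w : Fin 2 → ℤ) (k l : ℤ), 1 ≤ k ∧ d = k • w ∧ e = l • w := by
  have hg : 0 < Int.gcd (d 0) (d 1) := by
    rw [Int.gcd_pos_iff]
    by_contra h
    push Not at h
    apply hd
    funext i
    fin_cases i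
    · exact h.1
    · exact h.2
  obtain ⟨g, a, b, hg0, hab, ha, hb⟩ : ∃ g a b : ℤ, 0 < g ∧ IsCoprime a b ∧ d 0 = g * a ∧ d 1 = g * b := by
    obtain ⟨a, b, h1, h2, h3⟩ := Int.exists_gcd_one hg
    exact ⟨Int.gcd (d 0) (d 1), a, b, by exact_mod_cast hg, Int.isCoprime_iff_gcd_eq_one.2 h1,
      by rw [mul_comm]; exact h2, by rw [mul_comm]; exact h3⟩
  obtain ⟨r, s, hrs⟩ := hab
  have h : a * e 1 = b * e 0 := by
    rw [ha, hb] at hde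
    apply mul_left_cancel₀ hg0.ne'
    linarith
  refine ⟨![a, b], g, r * e 0 + s * e 1, by omega, ?_, ?_⟩
  · funext i; fin_cases i
    · simpa using ha
    · simpa using hb
  · funext i; fin_cases i
    · simp; linear_combination (-e 0) * hrs - s * h
    · simp; linear_combination (-e 1) * hrs + r * h

def auxDz (s z : Fin 2 → ℤ) : ℤ := s 0 * z 1 - s 1 * z 0

def auxDr (s : Fin 2 → ℤ) : (Fin 2 → ℝ) →ₗ[ℝ] ℝ :=
  (s 0 : ℝ) • LinearMap.proj 1 - (s 1 : ℝ) • LinearMap.proj 0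

theorem auxDr_apply (s : Fin 2 → ℤ) (z : Fin 2 → ℝ) : auxDr s z = s 0 * z 1 - s 1 * z 0 := by
  simp [auxDr]

theorem auxDr_toR2 (s z : Fin 2 → ℤ) : auxDr s (toR2 z) = (auxDz s z : ℝ) := by
  simp [auxDr_apply, auxDz, toR2]

theorem auxDz_add (s z w : Fin 2 → ℤ) : auxDz s (z + w) = auxDz s z + auxDz s w := by
  simp [auxDz]; ring

theorem auxDz_sub (s z w : Fin 2 → ℤ) : auxDz s (z - w) = auxDz s z - auxDz s w := by
  simp [auxDz]; ring

theorem auxDz_smul (s z : Fin 2 → ℤ) (k : ℤ) : auxDz s (k • z) = k * auxDz s z := by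
  simp [auxDz]; ring

theorem auxDz_neg (s z : Fin 2 → ℤ) : auxDz s (-z) = - auxDz s z := by
  simp [auxDz]; ring

theorem auxDz_neg' (s z : Fin 2 → ℤ) : auxDz (-s) z = - auxDz s z := by
  simp [auxDz]; ring

theorem auxDr_neg' (s : Fin 2 → ℤ) : auxDr (-s) = - auxDr s := by
  refine LinearMap.ext fun z => ?_
  simp [auxDr_apply]; ring

theorem toR2_add (z w : Fin 2 → ℤ) : toR2 (z + w) = toR2 z + toR2 w := by
  funext i; simp [toR2]

theorem toR2_sub (z w : Fin 2 → ℤ) : toR2 (z - w) = toR2 z - toR2 w := by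
  funext i; simp [toR2]

theorem toR2_smul (k : ℤ) (w : Fin 2 → ℤ) : toR2 (k • w) = (k : ℝ) • toR2 w := by
  funext i; simp [toR2]

theorem toR2_inj {z w : Fin 2 → ℤ} (h : toR2 z = toR2 w) : z = w := by
  funext i
  have := congrFun h i
  simpa [toR2] using this

theorem auxDr_inj (s t : Fin 2 → ℤ) (hst : auxDz s t ≠ 0) (a b : Fin 2 → ℝ)
    (h1 : auxDr s a = auxDr s b) (h2 : auxDr t a = auxDr t b) : a = b := by
  have hst' : ((s 0 : ℝ) * t 1 - s 1 * t 0) ≠ 0 := by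
    unfold auxDz at hst; exact_mod_cast hst
  rw [auxDr_apply, auxDr_apply] at h1 h2
  funext i
  fin_cases i
  · apply mul_left_cancel₀ hst'
    simp only [Fin.zero_eta]
    linear_combination (t 0 : ℝ) * h1 - (s 0 : ℝ) * h2
  · apply mul_left_cancel₀ hst'
    simp only [Fin.mk_one]
    linear_combination (t 1 : ℝ) * h1 - (s 1 : ℝ) * h2

/-- lattice steps along a segment stay in a convex set -/
theorem aux_step (P : Set (Fin 2 → ℝ)) (hP : Convex ℝ P) (A w : Fin 2 → ℤ) (k t : ℤ)
    (hk : 1 ≤ k) (ht : 0 ≤ t) (htk : t ≤ k) (hA : toR2 A ∈ P) (hB : toR2 (A + k • w) ∈ P) :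
    toR2 (A + t • w) ∈ P := by
  have hkR : (1:ℝ) ≤ k := by exact_mod_cast hk
  have htR : (0:ℝ) ≤ t := by exact_mod_cast ht
  have htkR : (t:ℝ) ≤ k := by exact_mod_cast htk
  have hk0 : (0:ℝ) < k := by linarith
  have := hP hA hB (a := 1 - (t:ℝ) / k) (b := (t:ℝ) / k)
    (by rw [sub_nonneg, div_le_one hk0]; exact htkR) (by positivity) (by ring)
  convert this using 1
  simp only [toR2_add, toR2_smul, smul_add, smul_smul, sub_smul, one_smul]
  rw [div_mul_cancel₀ _ hk0.ne']
  abel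

theorem aux_geotop (P Q : Set (Fin 2 → ℝ)) (hP : IsLatticePolytope2 P) (hQ : IsLatticePolytope2 Q)
    (hPQ : IsWeakMinkowskiSummand P Q) (s t p₁ p₂ : Fin 2 → ℤ) (D : ℤ) (hD : 0 < D)
    (hst : auxDz s t ≠ 0) (hp₁ : toR2 p₁ ∈ P) (hp₂ : toR2 p₂ ∈ P)
    (hx : auxDz s p₂ = auxDz s p₁ + D) (hy : auxDz t p₂ = auxDz t p₁)
    (hE : ∀ z, auxDz s p₁ < auxDz s z → auxDz s z < auxDz s p₁ + D → toR2 z ∉ P) :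
    ∃ a m : ℝ, 0 ≤ a ∧ 0 ≤ a + m * D ∧
      (∀ z, 0 < auxDz s z → auxDz s z < D → 0 ≤ auxDz t z →
        a + m * auxDz s z < auxDz t z) ∧
      ∃ g w : Fin 2 → ℤ, D ≤ auxDz s w ∧ (auxDz t w : ℝ) = m * auxDz s w ∧
        toR2 g ∈ Q ∧ toR2 (g + w) ∈ Q ∧
        ∀ z ∈ Q, auxDr t z - m * auxDr s z ≤ auxDz t g - m * auxDz s g := by
  classical
  obtain ⟨VP, hVP, hPe⟩ := hP
  obtain ⟨VQ, hVQ, hQe⟩ := hQ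
  have hPe' : P = convexHull ℝ ((VP.image toR2 : Finset (Fin 2 → ℝ)) : Set (Fin 2 → ℝ)) := by
    rw [hPe, Finset.coe_image]
  have hQe' : Q = convexHull ℝ ((VQ.image toR2 : Finset (Fin 2 → ℝ)) : Set (Fin 2 → ℝ)) := by
    rw [hQe, Finset.coe_image]
  have hPc : Convex ℝ P := by rw [hPe]; exact convex_convexHull ℝ _
  have hQc : Convex ℝ Q := by rw [hQe]; exact convex_convexHull ℝ _
  have hVPs : ∀ v ∈ VP, toR2 v ∈ P := fun v hv => by
    rw [hPe]; exact subset_convexHull ℝ _ ⟨v, hv, rfl⟩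
  have hVQs : ∀ v ∈ VQ, toR2 v ∈ Q := fun v hv => by
    rw [hQe]; exact subset_convexHull ℝ _ ⟨v, hv, rfl⟩
  obtain ⟨A', hA', B', hB', a, m, hAx, hBx, hAy, hBy, ha, ham, hle, hmem⟩ :=
    aux_strip (VP.image toR2) (auxDr s) (auxDr t) (auxDr_inj s t hst) D (by exact_mod_cast hD)
      (toR2 p₁) (toR2 p₂) (hPe' ▸ hp₁) (hPe' ▸ hp₂)
      (by rw [auxDr_toR2, auxDr_toR2, hx]; push_cast; ring)
      (by rw [auxDr_toR2, auxDr_toR2, hy])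
      (by
        intro v hv
        obtain ⟨z, hz, rfl⟩ := Finset.mem_image.1 hv
        rw [auxDr_toR2, auxDr_toR2]
        by_contra hc
        push Not at hc
        exact hE z (by exact_mod_cast hc.1) (by exact_mod_cast hc.2) (hVPs z hz))
  rw [← hPe'] at hle hmem
  obtain ⟨A, hA, rfl⟩ := Finset.mem_image.1 hA'
  obtain ⟨B, hB, rfl⟩ := Finset.mem_image.1 hB'
  simp only [auxDr_toR2] at hAx hBx hAy hBy hle hmem
  have hAx' : auxDz s A ≤ auxDz s p₁ := by exact_mod_cast hAx
  have hBx' : auxDz s p₁ + D ≤ auxDz s B := by exact_mod_cast hBx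
  have hAB : A ≠ B := by rintro rfl; omega
  obtain ⟨g', hg', h', hh', hne, hgh, hgmax⟩ := aux_face P Q (VQ.image toR2) (hVQ.image _) hQe' hPQ
    (auxDr t - m • auxDr s) (toR2 A) (toR2 B) (hVPs A hA) (hVPs B hB)
    (fun h => hAB (toR2_inj h)) (by simp [auxDr_toR2]; linarith)
    (by
      intro z hz
      have := hle z hz
      simp [auxDr_toR2]; linarith)
  obtain ⟨g, hg, rfl⟩ := Finset.mem_image.1 hg'
  obtain ⟨h, hh, rfl⟩ := Finset.mem_image.1 hh'
  simp only [LinearMap.sub_apply, LinearMap.smul_apply, smul_eq_mul, auxDr_toR2] at hgh hgmax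
  -- parallel
  have hpar : (B - A) 0 * (h - g) 1 = (B - A) 1 * (h - g) 0 := by
    have e1 : (auxDz t (B - A) : ℝ) = m * auxDz s (B - A) := by
      rw [auxDz_sub, auxDz_sub]; push_cast; linarith
    have e2 : (auxDz t (h - g) : ℝ) = m * auxDz s (h - g) := by
      rw [auxDz_sub, auxDz_sub]; push_cast; linarith
    have e3 : (auxDz t (B - A) * auxDz s (h - g) : ℝ) = auxDz t (h - g) * auxDz s (B - A) := by
      rw [e1, e2]; ring
    have e4 : auxDz t (B - A) * auxDz s (h - g) = auxDz t (h - g) * auxDz s (B - A) := by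
      exact_mod_cast e3
    apply mul_left_cancel₀ hst
    generalize B - A = d at *
    generalize h - g = e at *
    unfold auxDz at e4 ⊢
    linear_combination -e4
  obtain ⟨w, k, l, hk, hkw, hlw⟩ := aux_prim (B - A) (h - g) (sub_ne_zero.2 hAB.symm) hpar
  have hBe : B = A + k • w := by rw [← hkw]; abel
  have hhe : h = g + l • w := by rw [← hlw]; abel
  have hl0 : l ≠ 0 := by
    rintro rfl
    apply hne
    rw [hhe]; simp
  have hBs : auxDz s B = auxDz s A + k * auxDz s w := by rw [hBe, auxDz_add, auxDz_smul]
  have hBt : auxDz t B = auxDz t A + k * auxDz t w := by rw [hBe, auxDz_add, auxDz_smul]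
  have hw0 : 0 < auxDz s w := by
    by_contra hc
    push Not at hc
    nlinarith
  have hwm : (auxDz t w : ℝ) = m * auxDz s w := by
    have hkR : (k:ℝ) ≠ 0 := by
      have : k ≠ 0 := by omega
      exact_mod_cast this
    apply mul_left_cancel₀ hkR
    have h1 : (auxDz s B : ℝ) = auxDz s A + k * auxDz s w := by exact_mod_cast hBs
    have h2 : (auxDz t B : ℝ) = auxDz t A + k * auxDz t w := by exact_mod_cast hBt
    rw [h1, h2] at hBy
    linarith
  have hwD : D ≤ auxDz s w := by
    -- step t0 = floor
    set T := (auxDz s p₁ - auxDz s A) / auxDz s w with hT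
    have hT0 : 0 ≤ T := Int.ediv_nonneg (by omega) hw0.le
    have hT1 : T * auxDz s w ≤ auxDz s p₁ - auxDz s A := Int.ediv_mul_le _ hw0.ne'
    have hT2 : auxDz s p₁ - auxDz s A < (T + 1) * auxDz s w := by
      have := Int.lt_ediv_add_one_mul_self (auxDz s p₁ - auxDz s A) hw0
      exact this
    have hTk : T + 1 ≤ k := by
      by_contra hc
      have : k ≤ T := by omega
      nlinarith
    have hin := aux_step P hPc A w k (T + 1) hk (by omega) hTk (hVPs A hA) (hBe ▸ hVPs B hB)
    have hval : auxDz s (A + (T + 1) • w) = auxDz s A + (T + 1) * auxDz s w := by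
      rw [auxDz_add, auxDz_smul]
    by_contra hc
    refine hE _ ?_ ?_ hin
    · rw [hval]; linarith
    · rw [hval]; linarith
  refine ⟨a, m, ha, ?_, ?_, ?_⟩
  · exact ham
  · intro z h1 h2 h3
    by_contra hc
    push Not at hc
    refine hE (p₁ + z) ?_ ?_ (hmem _ ?_ ?_ ?_ ?_)
    · rw [auxDz_add]; linarith
    · rw [auxDz_add]; linarith
    · rw [auxDr_toR2, auxDz_add]; exact_mod_cast (by linarith)
    · rw [auxDr_toR2, auxDz_add]; exact_mod_cast (by linarith)
    · rw [auxDr_toR2, auxDz_add]; exact_mod_cast (by linarith)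
    · rw [auxDr_toR2, auxDr_toR2, auxDz_add, auxDz_add]; push_cast; linarith
  · have hhe' : g = h + (-l) • w := by rw [hhe, neg_smul]; abel
    rcases lt_or_gt_of_ne hl0 with hl | hl
    · refine ⟨h, w, hwD, hwm, hVQs h hh, ?_, ?_⟩
      · have := aux_step Q hQc h w (-l) 1 (by omega) (by omega) (by omega) (hVQs h hh)
          (hhe' ▸ hVQs g hg)
        simpa using this
      · intro z hz
        rw [← hgh]; exact hgmax z hz
    · refine ⟨g, w, hwD, hwm, hVQs g hg, ?_, ?_⟩
      · have := aux_step Q hQc g w l 1 (by omega) (by omega) (by omega) (hVQs g hg)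
          (hhe ▸ hVQs h hh)
        simpa using this
      · exact hgmax

theorem aux_qstrip (Q : Set (Fin 2 → ℝ)) (hQ : IsLatticePolytope2 Q)
    (s t p₁ p₂ : Fin 2 → ℤ) (D : ℤ) (hD : 0 < D)
    (hst : auxDz s t ≠ 0) (hp₁ : toR2 p₁ ∈ Q) (hp₂ : toR2 p₂ ∈ Q)
    (hx : auxDz s p₂ = auxDz s p₁ + D) (hy : auxDz t p₂ = auxDz t p₁)
    (hE : ∀ z, auxDz s p₁ < auxDz s z → auxDz s z < auxDz s p₁ + D → toR2 z ∉ Q) :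
    ∃ a m : ℝ, 0 ≤ a ∧ 0 ≤ a + m * D ∧
      (∀ z, 0 < auxDz s z → auxDz s z < D → 0 ≤ auxDz t z →
        a + m * auxDz s z < auxDz t z) ∧
      ∀ z, toR2 z ∈ Q → (auxDz t z : ℝ) - auxDz t p₁ ≤ a + m * (auxDz s z - auxDz s p₁) := by
  classical
  obtain ⟨VP, hVP, hPe⟩ := hQ
  have hPe' : Q = convexHull ℝ ((VP.image toR2 : Finset (Fin 2 → ℝ)) : Set (Fin 2 → ℝ)) := by
    rw [hPe, Finset.coe_image]
  have hVPs : ∀ v ∈ VP, toR2 v ∈ Q := fun v hv => by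
    rw [hPe]; exact subset_convexHull ℝ _ ⟨v, hv, rfl⟩
  obtain ⟨A', hA', B', hB', a, m, hAx, hBx, hAy, hBy, ha, ham, hle, hmem⟩ :=
    aux_strip (VP.image toR2) (auxDr s) (auxDr t) (auxDr_inj s t hst) D (by exact_mod_cast hD)
      (toR2 p₁) (toR2 p₂) (hPe' ▸ hp₁) (hPe' ▸ hp₂)
      (by rw [auxDr_toR2, auxDr_toR2, hx]; push_cast; ring)
      (by rw [auxDr_toR2, auxDr_toR2, hy])
      (by
        intro v hv
        obtain ⟨z, hz, rfl⟩ := Finset.mem_image.1 hv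
        rw [auxDr_toR2, auxDr_toR2]
        by_contra hc
        push Not at hc
        exact hE z (by exact_mod_cast hc.1) (by exact_mod_cast hc.2) (hVPs z hz))
  rw [← hPe'] at hle hmem
  refine ⟨a, m, ha, ham, ?_, ?_⟩
  · intro z h1 h2 h3
    by_contra hc
    push Not at hc
    simp only [auxDr_toR2] at hmem
    refine hE (p₁ + z) ?_ ?_ (hmem _ ?_ ?_ ?_ ?_)
    · rw [auxDz_add]; linarith
    · rw [auxDz_add]; linarith
    · rw [auxDr_toR2, auxDz_add]; exact_mod_cast (by linarith)
    · rw [auxDr_toR2, auxDz_add]; exact_mod_cast (by linarith)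
    · rw [auxDr_toR2, auxDz_add]; exact_mod_cast (by linarith)
    · rw [auxDr_toR2, auxDr_toR2, auxDz_add, auxDz_add]; push_cast; linarith
  · intro z hz
    have := hle _ hz
    simpa only [auxDr_toR2] using this

theorem aux_primdvd (v z : Fin 2 → ℤ) (hv : IsPrimitive2 v) (h : v 0 * z 1 = v 1 * z 0) :
    ∃ l : ℤ, z = l • v := by
  have hv0 : v ≠ 0 := by
    rintro rfl
    simp [IsPrimitive2] at hv
  obtain ⟨w, k, l, hk, hkw, hlw⟩ := aux_prim v z hv0 h
  have hk1 : k ∣ 1 := by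
    have : k ∣ (Int.gcd (v 0) (v 1) : ℤ) := Int.dvd_coe_gcd
      (by rw [hkw]; simp) (by rw [hkw]; simp)
    unfold IsPrimitive2 at hv
    rw [hv] at this
    simpa using this
  have : k = 1 := Int.eq_one_of_dvd_one (by omega) hk1
  subst this
  exact ⟨l, by rw [hlw, hkw]; simp⟩

theorem aux_bez (v : Fin 2 → ℤ) (hv : IsPrimitive2 v) (i : ℤ) : ∃ z, auxDz v z = i := by
  obtain ⟨r, s, h⟩ := Int.isCoprime_iff_gcd_eq_one.2 hv
  refine ⟨![-(i * s), i * r], ?_⟩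
  simp [auxDz]
  linear_combination i * h

theorem aux_main (P Q : Set (Fin 2 → ℝ)) (hP : IsLatticePolytope2 P) (hQ : IsLatticePolytope2 Q)
    (hPQ : IsWeakMinkowskiSummand P Q) (p₁ p₂ q₁ q₂ u v : Fin 2 → ℤ)
    (hu : p₂ = p₁ + u) (hv : q₂ = q₁ + v) (hup : IsPrimitive2 u) (hvp : IsPrimitive2 v)
    (hp₁ : toR2 p₁ ∈ P) (hp₂ : toR2 p₂ ∈ P) (hq₁ : toR2 q₁ ∈ Q) (hq₂ : toR2 q₂ ∈ Q)
    (hD : 2 ≤ auxDz u v)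
    (hE1 : ∀ z, auxDz (-v) p₁ < auxDz (-v) z → auxDz (-v) z < auxDz (-v) p₁ + auxDz u v →
      toR2 z ∉ P)
    (hE2 : ∀ z, auxDz u q₁ < auxDz u z → auxDz u z < auxDz u q₁ + auxDz u v →
      toR2 z ∉ Q) : False := by
  obtain ⟨D, hDe⟩ : ∃ D, D = auxDz u v := ⟨_, rfl⟩
  rw [← hDe] at hD hE1 hE2
  have hXu : auxDz (-v) u = D := by rw [hDe]; simp [auxDz]; ring
  have hXv : auxDz (-v) v = 0 := by simp [auxDz]; ring
  have hYu : auxDz u u = 0 := by simp [auxDz]; ring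
  have hYv : auxDz u v = D := hDe.symm
  have hn1 : auxDz (-v) u ≠ 0 := by omega
  have hn2 : auxDz (-v) (-u) ≠ 0 := by rw [auxDz_neg]; omega
  have hn3 : auxDz u (-v) ≠ 0 := by rw [auxDz_neg]; omega
  have hn4 : auxDz u v ≠ 0 := by omega
  have hpX : auxDz (-v) p₂ = auxDz (-v) p₁ + D := by rw [hu, auxDz_add, hXu]
  have hpY : auxDz u p₂ = auxDz u p₁ := by rw [hu, auxDz_add, hYu, add_zero]
  have hqX : auxDz (-v) q₂ = auxDz (-v) q₁ := by rw [hv, auxDz_add, hXv, add_zero]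
  have hqY : auxDz u q₂ = auxDz u q₁ + D := by rw [hv, auxDz_add, hYv]
  obtain ⟨a, m, ha, ham, hm, g, w, hgw1, hgw2, hg, hgw, hgmax⟩ :=
    aux_geotop P Q hP hQ hPQ (-v) u p₁ p₂ D (by omega) hn1 hp₁ hp₂ hpX hpY hE1
  obtain ⟨a', m', ha', ham', hm', g', w', hgw1', hgw2', hg', hgw', hgmax'⟩ :=
    aux_geotop P Q hP hQ hPQ (-v) (-u) p₁ p₂ D (by omega) hn2 hp₁ hp₂ hpX
      (by rw [auxDz_neg', auxDz_neg', hpY]) hE1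
  obtain ⟨b, n, hb, hbn, hn, hnle⟩ :=
    aux_qstrip Q hQ u (-v) q₁ q₂ D (by omega) hn3 hq₁ hq₂ hqY hqX hE2
  obtain ⟨b', n', hb', hbn', hn', hnle'⟩ :=
    aux_qstrip Q hQ u v q₁ q₂ D (by omega) hn4 hq₁ hq₂ hqY
      (by rw [auxDz_neg', auxDz_neg'] at hqX; omega) hE2
  have hvneg : ∀ z, auxDz v z = - auxDz (-v) z := by intro z; rw [auxDz_neg']; ring
  simp only [hvneg] at hn' hnle'
  rw [auxDr_neg'] at hgmax'
  simp only [auxDz_neg' u] at hm' hgw2' hgmax'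
  let L : ℤ → ℤ → Prop := fun i j => ∃ z, auxDz (-v) z = i ∧ auxDz u z = j
  have hsub : ∀ i j i' j' k l : ℤ, L i j → i' = i - k * D → j' = j - l * D → L i' j' := by
    rintro i j i' j' k l ⟨z, rfl, rfl⟩ rfl rfl
    refine ⟨z - k • u - l • v, ?_, ?_⟩
    · simp only [auxDz_sub, auxDz_smul, hXu, hXv]; ring
    · simp only [auxDz_sub, auxDz_smul, hYu, hYv]; ring
  have hneg : ∀ i j, L i j → L (-i) (-j) := by
    rintro i j ⟨z, rfl, rfl⟩
    exact ⟨-z, auxDz_neg _ _, auxDz_neg _ _⟩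
  have h0 : ∀ j, L 0 j → D ∣ j := by
    rintro j ⟨z, h, rfl⟩
    obtain ⟨l, rfl⟩ := aux_primdvd v z hvp (by simp [auxDz] at h; linarith)
    rw [auxDz_smul, hYv]; exact dvd_mul_left _ _
  have h0' : ∀ j, L j 0 → D ∣ j := by
    rintro j ⟨z, rfl, h⟩
    obtain ⟨l, rfl⟩ := aux_primdvd u z hup (by simp [auxDz] at h; linarith)
    rw [auxDz_smul, hXu]; exact dvd_mul_left _ _
  have hex : ∀ i, ∃ j, L i j := by
    intro i
    obtain ⟨z, hz⟩ := aux_bez v hvp (-i)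
    exact ⟨_, z, by rw [auxDz_neg', hz]; ring, rfl⟩
  have hex' : ∀ j, ∃ i, L i j := by
    intro i
    obtain ⟨z, hz⟩ := aux_bez u hup i
    exact ⟨_, z, rfl, hz⟩
  have hLn : ∀ i j, L i j → 0 < j → j < D → 0 ≤ i → b + n * j < i := by
    rintro i j ⟨z, rfl, rfl⟩ h1 h2 h3
    exact hn z h1 h2 h3
  have hLn' : ∀ i j, L i j → 0 < j → j < D → i ≤ 0 → i < -b' + -n' * j := by
    rintro i j ⟨z, rfl, rfl⟩ h1 h2 h3
    have := hn' z h1 h2 (by omega)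
    push_cast at this; linarith
  have hstripQ : ∀ z, toR2 z ∈ Q → auxDz u z ≤ auxDz u q₁ ∨ auxDz u q₁ + D ≤ auxDz u z := by
    intro z hz
    by_contra hc
    push Not at hc
    exact hE2 z hc.1 hc.2 hz
  have hXR : (auxDz (-v) q₂ : ℝ) = auxDz (-v) q₁ := by exact_mod_cast hqX
  have hYR : (auxDz u q₂ : ℝ) = auxDz u q₁ + D := by exact_mod_cast hqY
  -- top
  obtain ⟨y1, hy1, hW1⟩ := aux_top D hD L hsub hneg h0 h0' hex hex' a m b n (-b') (-n') ha ham
    (by rintro i j ⟨z, rfl, rfl⟩ h1 h2 h3; exact hm z h1 h2 h3) hb hbn hLn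
    (by linarith) (by linarith) hLn'
    (auxDz (-v) g - auxDz (-v) q₁) (auxDz u g - auxDz u q₁) (auxDz (-v) w) (auxDz u w)
    ⟨w, rfl, rfl⟩ hgw1 hgw2
    (by have := hstripQ g hg; omega)
    (by have := hstripQ _ hgw; rw [auxDz_add] at this; omega)
    (by
      have := hgmax _ hq₂
      rw [auxDr_toR2, auxDr_toR2, hXR, hYR] at this
      push_cast; linarith)
    (by have := hnle' _ hg; push_cast at *; linarith)
    (by have := hnle _ hg; push_cast at *; linarith)
    (by have := hnle _ hgw; simp only [auxDz_add] at this; push_cast at *; linarith)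
    (by have := hnle' _ hgw; simp only [auxDz_add] at this; push_cast at *; linarith)
  -- bottom
  obtain ⟨y2, hy2, hW2⟩ := aux_top D hD (fun i j => L i (-j))
    (fun i j i' j' k l h h1 h2 => hsub i (-j) i' (-j') k (-l) h h1 (by rw [h2]; ring))
    (fun i j h => hneg _ _ h) (fun j h => by simpa using h0 _ h)
    (fun i h => h0' i (by simpa using h))
    (fun i => by obtain ⟨j, h⟩ := hex i; exact ⟨-j, by simpa using h⟩) (fun j => hex' (-j))
    a' m' (b + n * D) (-n) (-b' - n' * D) n' ha' ham'
    (by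
      rintro i j ⟨z, rfl, hz⟩ h1 h2 h3
      have := hm' z h1 h2 (by omega)
      rw [hz] at this
      simpa using this) hbn (by linarith)
    (by
      intro i j h h1 h2 h3
      have := hLn i (D - j) (hsub _ _ _ _ 0 (-1) h (by ring) (by ring)) (by omega) (by omega) h3
      push_cast at this; linarith)
    (by linarith) (by linarith)
    (by
      intro i j h h1 h2 h3
      have := hLn' i (D - j) (hsub _ _ _ _ 0 (-1) h (by ring) (by ring)) (by omega) (by omega) h3
      push_cast at this; linarith)
    (auxDz (-v) g' - auxDz (-v) q₁) (D - (auxDz u g' - auxDz u q₁)) (auxDz (-v) w') (-auxDz u w')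
    ⟨w', rfl, by ring⟩ hgw1' (by exact_mod_cast hgw2')
    (by have := hstripQ g' hg'; omega)
    (by have := hstripQ _ hgw'; rw [auxDz_add] at this; omega)
    (by
      have := hgmax' _ hq₁
      rw [LinearMap.neg_apply, auxDr_toR2, auxDr_toR2] at this
      push_cast at *; linarith)
    (by have := hnle' _ hg'; push_cast at *; linarith)
    (by have := hnle _ hg'; push_cast at *; linarith)
    (by have := hnle _ hgw'; simp only [auxDz_add] at this; push_cast at *; linarith)
    (by have := hnle' _ hgw'; simp only [auxDz_add] at this; push_cast at *; linarith)
  -- width at height 1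
  obtain ⟨i, hi, hi1, hi2⟩ := aux_slope D hD (fun i j => L j i)
    (fun i j i' j' k l h h1 h2 => hsub j i j' i' l k h h2 h1) h0 hex' 1 (by omega) (by omega)
  have c1 := hLn i 1 hi (by omega) (by omega) (by omega)
  have c2 := hLn' (i - D) 1 (hsub _ _ _ _ 1 0 hi (by ring) (by ring)) (by omega) (by omega)
    (by omega)
  push_cast at c1 c2
  have hDR : (2:ℝ) ≤ D := by exact_mod_cast hD
  -- W(z) = (b + b') + (n + n') z
  have w0 : (b + b') + (n + n') < D := by linarith
  have w1 : (D:ℝ) ≤ (b + b') + (n + n') * y1 := by linarith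
  have w2 : (D:ℝ) ≤ (b + b') + (n + n') * (D - y2) := by linarith
  rcases le_total 0 (n + n') with h | h
  · nlinarith
  · nlinarith

theorem aux_mem_strip (p₁ u v z : Fin 2 → ℤ) (hD : 0 < auxDz u v)
    (h1 : auxDz (-v) p₁ < auxDz (-v) z) (h2 : auxDz (-v) z < auxDz (-v) p₁ + auxDz u v) :
    toR2 z ∈ openSegment ℝ (toR2 p₁) (toR2 (p₁ + u)) + lineSpanned (toR2 v) := by
  have hDR : (0:ℝ) < auxDz u v := by exact_mod_cast hD
  have h1R : (0:ℝ) < auxDz (-v) (z - p₁) := by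
    rw [auxDz_sub]; exact_mod_cast (by linarith)
  have h2R : (auxDz (-v) (z - p₁) : ℝ) < auxDz u v := by
    rw [auxDz_sub]; exact_mod_cast (by linarith)
  set s : ℝ := auxDz (-v) (z - p₁) / auxDz u v with hs
  set t : ℝ := auxDz u (z - p₁) / auxDz u v with ht
  refine Set.mem_add.2 ⟨(1 - s) • toR2 p₁ + s • toR2 (p₁ + u),
    ⟨1 - s, s, ?_, by positivity, by ring, rfl⟩, t • toR2 v, ⟨t, rfl⟩, ?_⟩
  · rw [sub_pos, hs, div_lt_one hDR]; exact h2R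
  · have hs' : s * auxDz u v = auxDz (-v) (z - p₁) := div_mul_cancel₀ _ hDR.ne'
    have ht' : t * auxDz u v = auxDz u (z - p₁) := div_mul_cancel₀ _ hDR.ne'
    have hne := hDR.ne'
    clear_value s t
    simp only [auxDz, Pi.neg_apply, Pi.sub_apply] at hs' ht' hne
    push_cast at hs' ht' hne
    funext i
    fin_cases i
    · apply mul_left_cancel₀ hne
      simp [toR2, -mul_eq_mul_left_iff]
      linear_combination (u 0 : ℝ) * hs' + (v 0 : ℝ) * ht'
    · apply mul_left_cancel₀ hne
      simp [toR2, -mul_eq_mul_left_iff]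
      linear_combination (u 1 : ℝ) * hs' + (v 1 : ℝ) * ht'

theorem lineSpanned_neg (d : Fin 2 → ℝ) : lineSpanned (-d) = lineSpanned d := by
  ext z
  constructor
  · rintro ⟨t, rfl⟩; exact ⟨-t, by simp⟩
  · rintro ⟨t, rfl⟩; exact ⟨-t, by simp⟩

theorem aux_final (P Q : Set (Fin 2 → ℝ)) (hP : IsLatticePolytope2 P) (hQ : IsLatticePolytope2 Q)
    (hPQ : IsWeakMinkowskiSummand P Q) (p₁ p₂ q₁ q₂ : Fin 2 → ℤ)
    (hpprim : IsPrimitive2 (p₂ - p₁)) (hqprim : IsPrimitive2 (q₂ - q₁))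
    (hp₁ : toR2 p₁ ∈ P) (hp₂ : toR2 p₂ ∈ P) (hq₁ : toR2 q₁ ∈ Q) (hq₂ : toR2 q₂ ∈ Q)
    (hD : 2 ≤ auxDz (p₂ - p₁) (q₂ - q₁)) :
    (∃ z : Fin 2 → ℤ, toR2 z ∈
        (openSegment ℝ (toR2 p₁) (toR2 p₂) + lineSpanned (toR2 q₂ - toR2 q₁)) ∩ P) ∨
    (∃ z : Fin 2 → ℤ, toR2 z ∈
        (openSegment ℝ (toR2 q₁) (toR2 q₂) + lineSpanned (toR2 p₂ - toR2 p₁)) ∩ Q) := by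
  by_contra hc
  push Not at hc
  obtain ⟨c1, c2⟩ := hc
  have hpe : p₂ = p₁ + (p₂ - p₁) := by abel
  have hqe : q₂ = q₁ + (q₂ - q₁) := by abel
  refine aux_main P Q hP hQ hPQ p₁ p₂ q₁ q₂ (p₂ - p₁) (q₂ - q₁) hpe hqe hpprim hqprim
    hp₁ hp₂ hq₁ hq₂ hD ?_ ?_
  · intro z h1 h2 hz
    refine c1 z ⟨?_, hz⟩
    have := aux_mem_strip p₁ (p₂ - p₁) (q₂ - q₁) z (by omega) h1 h2
    rwa [← hpe, toR2_sub] at this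
  · intro z h1 h2 hz
    refine c2 z ⟨?_, hz⟩
    have hsw : auxDz (q₂ - q₁) (-(p₂ - p₁)) = auxDz (p₂ - p₁) (q₂ - q₁) := by
      simp [auxDz]; ring
    have := aux_mem_strip q₁ (q₂ - q₁) (-(p₂ - p₁)) z (by omega) (by rwa [neg_neg])
      (by rwa [neg_neg, hsw])
    rw [← hqe] at this
    have e : toR2 (-(p₂ - p₁)) = -(toR2 p₂ - toR2 p₁) := by
      rw [← toR2_sub]; funext i; simp [toR2]
    rwa [e, lineSpanned_neg] at this

/-- Let `Q` be a two-dimensional lattice polytope and `P` a lattice polytope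
which is a weak Minkowski summand of `Q`.  Let `p = [p₁,p₂] ⊆ P` and
`q = [q₁,q₂] ⊆ Q` be primitive, non-parallel lattice segments.  If the
parallelogram `p + q` is not unimodular, then at least one of the sets
`((p₁,p₂) + L_q) ∩ P` and `((q₁,q₂) + L_p) ∩ Q` contains a lattice point. -/
theorem strip_contains_lattice_point
    (P Q : Set (Fin 2 → ℝ))
    (hQ : IsLatticePolytope2 Q) (hQdim : affineSpan ℝ Q = ⊤)
    (hP : IsLatticePolytope2 P)
    (hPQ : IsWeakMinkowskiSummand P Q)
    (p₁ p₂ q₁ q₂ : Fin 2 → ℤ)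
    (hpP : segment ℝ (toR2 p₁) (toR2 p₂) ⊆ P)
    (hqQ : segment ℝ (toR2 q₁) (toR2 q₂) ⊆ Q)
    (hpprim : IsPrimitive2 (p₂ - p₁))
    (hqprim : IsPrimitive2 (q₂ - q₁))
    (hpar : ¬ ∃ t : ℝ, toR2 q₂ - toR2 q₁ = t • (toR2 p₂ - toR2 p₁))
    (hnotuni : (Matrix.of ![p₂ - p₁, q₂ - q₁]).det ∉ ({1, -1} : Set ℤ)) :
    (∃ z : Fin 2 → ℤ, toR2 z ∈
        (openSegment ℝ (toR2 p₁) (toR2 p₂) + lineSpanned (toR2 q₂ - toR2 q₁)) ∩ P) ∨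
    (∃ z : Fin 2 → ℤ, toR2 z ∈
        (openSegment ℝ (toR2 q₁) (toR2 q₂) + lineSpanned (toR2 p₂ - toR2 p₁)) ∩ Q) := by
  have hp₁ := hpP (left_mem_segment ℝ _ _)
  have hp₂ := hpP (right_mem_segment ℝ _ _)
  have hq₁ := hqQ (left_mem_segment ℝ _ _)
  have hq₂ := hqQ (right_mem_segment ℝ _ _)
  have hdet : (Matrix.of ![p₂ - p₁, q₂ - q₁]).det = auxDz (p₂ - p₁) (q₂ - q₁) := by
    rw [Matrix.det_fin_two]; simp [auxDz]
  rw [hdet] at hnotuni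
  simp only [Set.mem_insert_iff, Set.mem_singleton_iff, not_or] at hnotuni
  have hne : auxDz (p₂ - p₁) (q₂ - q₁) ≠ 0 := by
    intro h
    obtain ⟨l, hl⟩ := aux_primdvd _ (q₂ - q₁) hpprim (by unfold auxDz at h; linarith)
    exact hpar ⟨l, by rw [← toR2_sub, ← toR2_sub, hl, toR2_smul]⟩
  rcases lt_or_gt_of_ne hne with h | h
  · have hneg : p₁ - p₂ = -(p₂ - p₁) := by abel
    have := aux_final P Q hP hQ hPQ p₂ p₁ q₁ q₂
      (by
        unfold IsPrimitive2 at hpprim ⊢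
        rw [hneg]
        rw [Pi.neg_apply, Pi.neg_apply, Int.gcd_neg, Int.neg_gcd]
        exact hpprim) hqprim hp₂ hp₁ hq₁ hq₂
      (by rw [hneg, auxDz_neg']; omega)
    rw [openSegment_symm ℝ (toR2 p₂), ← neg_sub (toR2 p₂) (toR2 p₁), lineSpanned_neg] at this
    exact this
  · exact aux_final P Q hP hQ hPQ p₁ p₂ q₁ q₂ hpprim hqprim hp₁ hp₂ hq₁ hq₂ (by omega)
end
end

section
/- Let Q ⊂ ℝ^2 be a lattice polygon, let P ⊂ ℝ^2 be a lattice polytope that is a weak Minkowski summand of Q, and let T be an empty lattice tetrahedron contained in the Cayley sum Cay(P,Q) ⊂ ℝ^3. Then T can be covered by unimodular tetrahedra contained in Cay(P,Q). -/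
open scoped Pointwise

noncomputable section

/-- The real point corresponding to an integer point of `ℤ³`. -/
def toR3 (v : Fin 3 → ℤ) : Fin 3 → ℝ := fun i => (v i : ℝ)

/-- A unimodular tetrahedron: the convex hull of lattice points `v0, v1, v2, v3`
such that `v1 - v0, v2 - v0, v3 - v0` form a `ℤ`-basis of `ℤ³`. -/
def IsUnimodularTet (S : Set (Fin 3 → ℝ)) : Prop :=
  ∃ v : Fin 4 → Fin 3 → ℤ,
    S = convexHull ℝ {toR3 (v 0), toR3 (v 1), toR3 (v 2), toR3 (v 3)} ∧
    (Matrix.of ![v 1 - v 0, v 2 - v 0, v 3 - v 0]).det ∈ ({1, -1} : Set ℤ)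

/-- An empty lattice tetrahedron: four affinely independent lattice points whose
convex hull contains no lattice points other than its vertices. -/
def EmptyLatticeTet (p : Fin 4 → Fin 3 → ℤ) : Prop :=
  AffineIndependent ℝ (fun i => toR3 (p i)) ∧
  ∀ z : Fin 3 → ℤ,
    toR3 z ∈ convexHull ℝ (Set.range fun i => toR3 (p i)) → ∃ i, z = p i

/-- The Cayley sum `Cay(P,Q) = conv(P×{0} ∪ Q×{1}) ⊆ ℝ³`. -/
def cay (P Q : Set (Fin 2 → ℝ)) : Set (Fin 3 → ℝ) :=
  convexHull ℝ
    ((fun x => Fin.snoc x (0:ℝ)) '' P ∪ (fun x => Fin.snoc x (1:ℝ)) '' Q)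

lemma hull4 {E : Type*} [AddCommGroup E] [Module ℝ E] (w0 w1 w2 w3 x : E) :
    x ∈ convexHull ℝ {w0, w1, w2, w3} ↔ ∃ m0 m1 m2 m3 : ℝ, 0 ≤ m0 ∧ 0 ≤ m1 ∧ 0 ≤ m2 ∧ 0 ≤ m3 ∧
      m0 + m1 + m2 + m3 = 1 ∧ x = m0 • w0 + m1 • w1 + m2 • w2 + m3 • w3 := by
  constructor
  · intro hx
    refine convexHull_min (t := {x | ∃ m0 m1 m2 m3 : ℝ, 0 ≤ m0 ∧ 0 ≤ m1 ∧ 0 ≤ m2 ∧ 0 ≤ m3 ∧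
      m0 + m1 + m2 + m3 = 1 ∧ x = m0 • w0 + m1 • w1 + m2 • w2 + m3 • w3}) ?_ ?_ hx
    · rintro y (rfl | rfl | rfl | rfl)
      · exact ⟨1, 0, 0, 0, by norm_num, by norm_num, by norm_num, by norm_num, by norm_num, by module⟩
      · exact ⟨0, 1, 0, 0, by norm_num, by norm_num, by norm_num, by norm_num, by norm_num, by module⟩
      · exact ⟨0, 0, 1, 0, by norm_num, by norm_num, by norm_num, by norm_num, by norm_num, by module⟩
      · exact ⟨0, 0, 0, 1, by norm_num, by norm_num, by norm_num, by norm_num, by norm_num, by module⟩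
    · rintro y ⟨m0, m1, m2, m3, h0, h1, h2, h3, hs, rfl⟩ z ⟨n0, n1, n2, n3, g0, g1, g2, g3, gs, rfl⟩
        a b ha hb hab
      refine ⟨a * m0 + b * n0, a * m1 + b * n1, a * m2 + b * n2, a * m3 + b * n3, by positivity,
        by positivity, by positivity, by positivity, ?_, by module⟩
      linear_combination a * hs + b * gs + hab
  · rintro ⟨m0, m1, m2, m3, h0, h1, h2, h3, hs, rfl⟩
    have := (convex_convexHull ℝ ({w0, w1, w2, w3} : Set E)).sum_mem (t := Finset.univ)
      (w := ![m0, m1, m2, m3]) (z := ![w0, w1, w2, w3]) ?_ ?_ ?_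
    · simpa [Fin.sum_univ_four] using this
    · intro i _
      fin_cases i <;> assumption
    · simpa [Fin.sum_univ_four] using hs
    · intro i _
      apply subset_convexHull
      fin_cases i <;> simp

lemma stellar {E : Type*} [AddCommGroup E] [Module ℝ E] (w0 w1 w2 w3 c x : E) (l0 l1 l2 l3 : ℝ)
    (hl : l0 + l1 + l2 + l3 = 1) (hc : c = l0 • w0 + l1 • w1 + l2 • w2 + l3 • w3)
    (hx : x ∈ convexHull ℝ {w0, w1, w2, w3}) :
    (0 < l0 ∧ x ∈ convexHull ℝ {c, w1, w2, w3}) ∨ (0 < l1 ∧ x ∈ convexHull ℝ {w0, c, w2, w3}) ∨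
    (0 < l2 ∧ x ∈ convexHull ℝ {w0, w1, c, w3}) ∨ (0 < l3 ∧ x ∈ convexHull ℝ {w0, w1, w2, c}) := by
  obtain ⟨m0, m1, m2, m3, h0, h1, h2, h3, hs, hx⟩ := (hull4 _ _ _ _ _).1 hx
  set l : Fin 4 → ℝ := ![l0, l1, l2, l3] with hldef
  set m : Fin 4 → ℝ := ![m0, m1, m2, m3] with hmdef
  have hm : ∀ i, 0 ≤ m i := by
    intro i; fin_cases i <;> assumption
  have hne : (Finset.univ.filter (fun i => 0 < l i)).Nonempty := by
    by_contra hcon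
    rw [Finset.not_nonempty_iff_eq_empty, Finset.filter_eq_empty_iff] at hcon
    have a0 := hcon (Finset.mem_univ 0)
    have a1 := hcon (Finset.mem_univ 1)
    have a2 := hcon (Finset.mem_univ 2)
    have a3 := hcon (Finset.mem_univ 3)
    simp [l] at a0 a1 a2 a3
    linarith
  obtain ⟨i, hi, hmin⟩ := Finset.exists_min_image _ (fun i => m i / l i) hne
  simp only [Finset.mem_filter, Finset.mem_univ, true_and] at hi hmin
  obtain ⟨ρ, hρ⟩ : ∃ ρ, ρ = m i / l i := ⟨_, rfl⟩
  have hρ0 : 0 ≤ ρ := by rw [hρ]; exact div_nonneg (hm i) hi.le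
  have hmi : m i = ρ * l i := by rw [hρ]; field_simp
  have key : ∀ j, 0 ≤ m j - ρ * l j := by
    intro j
    rcases le_or_gt (l j) 0 with h | h
    · nlinarith [hm j]
    · have := hmin j h
      rw [← hρ, le_div_iff₀ h] at this
      linarith
  have k0 : 0 ≤ m0 - ρ * l0 := key 0
  have k1 : 0 ≤ m1 - ρ * l1 := key 1
  have k2 : 0 ≤ m2 - ρ * l2 := key 2
  have k3 : 0 ≤ m3 - ρ * l3 := key 3
  clear_value l m
  fin_cases i
  · have e : m0 = ρ * l0 := by simpa [hldef, hmdef] using hmi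
    refine Or.inl ⟨by simpa [hldef] using hi, (hull4 _ _ _ _ _).2
      ⟨ρ, m1 - ρ * l1, m2 - ρ * l2, m3 - ρ * l3, hρ0, k1, k2, k3, ?_, ?_⟩⟩
    · linear_combination hs - ρ * hl - e
    · rw [hx, hc, e]; module
  · have e : m1 = ρ * l1 := by simpa [hldef, hmdef] using hmi
    refine Or.inr (Or.inl ⟨by simpa [hldef] using hi, (hull4 _ _ _ _ _).2
      ⟨m0 - ρ * l0, ρ, m2 - ρ * l2, m3 - ρ * l3, k0, hρ0, k2, k3, ?_, ?_⟩⟩)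
    · linear_combination hs - ρ * hl - e
    · rw [hx, hc, e]; module
  · have e : m2 = ρ * l2 := by simpa [hldef, hmdef] using hmi
    refine Or.inr (Or.inr (Or.inl ⟨by simpa [hldef] using hi, (hull4 _ _ _ _ _).2
      ⟨m0 - ρ * l0, m1 - ρ * l1, ρ, m3 - ρ * l3, k0, k1, hρ0, k3, ?_, ?_⟩⟩))
    · linear_combination hs - ρ * hl - e
    · rw [hx, hc, e]; module
  · have e : m3 = ρ * l3 := by simpa [hldef, hmdef] using hmi
    refine Or.inr (Or.inr (Or.inr ⟨by simpa [hldef] using hi, (hull4 _ _ _ _ _).2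
      ⟨m0 - ρ * l0, m1 - ρ * l1, m2 - ρ * l2, ρ, k0, k1, k2, hρ0, ?_, ?_⟩⟩))
    · linear_combination hs - ρ * hl - e
    · rw [hx, hc, e]; module

/-- The planar determinant. -/
def D2 (u v : Fin 2 → ℤ) : ℤ := u 0 * v 1 - u 1 * v 0

/-- Lattice point of the plane put at height `h`. -/
def lift3 (w : Fin 2 → ℤ) (h : ℤ) : Fin 3 → ℤ := ![w 0, w 1, h]

/-- A primitive vector can be completed to a basis, with normalised second vector. -/
lemma exists_z (u v : Fin 2 → ℤ) (hq : 0 < D2 u v) (hu : Int.gcd (u 0) (u 1) = 1) :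
    ∃ z : Fin 2 → ℤ, D2 u z = 1 ∧ 0 ≤ D2 z v ∧ D2 z v < D2 u v := by
  have hb := Int.gcd_eq_gcd_ab (u 0) (u 1)
  rw [hu] at hb
  obtain ⟨z, hz⟩ : ∃ z : Fin 2 → ℤ, D2 u z = 1 :=
    ⟨![-(u 0).gcdB (u 1), (u 0).gcdA (u 1)], by simp [D2]; push_cast at hb; linarith⟩
  refine ⟨z - (D2 z v / D2 u v) • u, ?_, ?_, ?_⟩
  · simp only [D2, Pi.sub_apply, Pi.smul_apply, smul_eq_mul] at hz ⊢; linear_combination hz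
  · have h : D2 (z - (D2 z v / D2 u v) • u) v = D2 z v % D2 u v := by
      rw [Int.emod_def]
      simp only [D2, Pi.sub_apply, Pi.smul_apply, smul_eq_mul]; ring
    rw [h]; exact Int.emod_nonneg _ hq.ne'
  · have h : D2 (z - (D2 z v / D2 u v) • u) v = D2 z v % D2 u v := by
      rw [Int.emod_def]
      simp only [D2, Pi.sub_apply, Pi.smul_apply, smul_eq_mul]; ring
    rw [h]; exact Int.emod_lt_of_pos _ hq

/-- A non-primitive vector is a proper multiple. -/
lemma exists_div (u : Fin 2 → ℤ) (hu0 : u ≠ 0) (hu : Int.gcd (u 0) (u 1) ≠ 1) :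
    ∃ (g : ℤ) (w : Fin 2 → ℤ), 2 ≤ g ∧ u = g • w := by
  have h0 : Int.gcd (u 0) (u 1) ≠ 0 := by
    intro h
    rw [Int.gcd_eq_zero_iff] at h
    apply hu0; ext i; fin_cases i
    · exact h.1
    · exact h.2
  obtain ⟨c, hc⟩ := Int.gcd_dvd_left (a := u 0) (b := u 1)
  obtain ⟨d, hd⟩ := Int.gcd_dvd_right (a := u 0) (b := u 1)
  refine ⟨Int.gcd (u 0) (u 1), ![c, d], by omega, ?_⟩
  ext i; fin_cases i
  · simpa using hc
  · simpa using hd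

lemma tri_pos (w0 w1 w2 : Fin 2 → ℤ) (hD : 2 ≤ D2 (w1 - w0) (w2 - w0)) :
    ∃ (c : Fin 2 → ℤ) (N n0 n1 n2 : ℤ), 0 ≤ n0 ∧ 0 ≤ n1 ∧ 0 ≤ n2 ∧ n0 < N ∧ n1 < N ∧ n2 < N ∧
      n0 + n1 + n2 = N ∧ ∀ k, N * c k = n0 * w0 k + n1 * w1 k + n2 * w2 k := by
  by_cases hu : Int.gcd ((w1 - w0) 0) ((w1 - w0) 1) = 1
  · obtain ⟨z, hz, hz0, hz1⟩ := exists_z (w1 - w0) (w2 - w0) (by omega) hu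
    refine ⟨w0 + z, D2 (w1 - w0) (w2 - w0), D2 (w1 - w0) (w2 - w0) - D2 z (w2 - w0) - 1,
      D2 z (w2 - w0), 1, by omega, by omega, by omega, by omega, by omega, by omega, by omega, ?_⟩
    intro k
    fin_cases k
    · simp [D2] at hz ⊢; linear_combination (w2 0 - w0 0) * hz
    · simp [D2] at hz ⊢; linear_combination (w2 1 - w0 1) * hz
  · obtain ⟨g, w, hg, hw⟩ := exists_div (w1 - w0) (by rintro h; rw [h] at hD; simp [D2] at hD) hu
    refine ⟨w0 + w, g, g - 1, 1, 0, by omega, by omega, by omega, by omega, by omega, by omega,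
      by omega, ?_⟩
    intro k
    have := congrFun hw k
    simp at this ⊢
    linear_combination -this

lemma tri (w0 w1 w2 : Fin 2 → ℤ) (hD : 2 ≤ |D2 (w1 - w0) (w2 - w0)|) :
    ∃ (c : Fin 2 → ℤ) (N n0 n1 n2 : ℤ), 0 ≤ n0 ∧ 0 ≤ n1 ∧ 0 ≤ n2 ∧ n0 < N ∧ n1 < N ∧ n2 < N ∧
      n0 + n1 + n2 = N ∧ ∀ k, N * c k = n0 * w0 k + n1 * w1 k + n2 * w2 k := by
  rcases le_or_gt 0 (D2 (w1 - w0) (w2 - w0)) with h | h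
  · rw [abs_of_nonneg h] at hD
    exact tri_pos _ _ _ hD
  · rw [abs_of_neg h] at hD
    obtain ⟨c, N, n0, n1, n2, a0, a1, a2, b0, b1, b2, hs, hk⟩ := tri_pos w0 w2 w1
      (by simp only [D2] at hD ⊢; linarith)
    exact ⟨c, N, n0, n2, n1, a0, a2, a1, b0, b2, b1, by linarith, fun k => by rw [hk]; ring⟩

/-- `x` lies in a unimodular tetrahedron contained in `K`. -/
def Good (K : Set (Fin 3 → ℝ)) (x : Fin 3 → ℝ) : Prop :=
  ∃ S, IsUnimodularTet S ∧ S ⊆ K ∧ x ∈ S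

lemma good_of_det (K : Set (Fin 3 → ℝ)) (hK : Convex ℝ K) (w0 w1 w2 w3 : Fin 3 → ℤ)
    (h0 : toR3 w0 ∈ K) (h1 : toR3 w1 ∈ K) (h2 : toR3 w2 ∈ K) (h3 : toR3 w3 ∈ K)
    (hd : (Matrix.of ![w1 - w0, w2 - w0, w3 - w0]).det ∈ ({1, -1} : Set ℤ))
    (x : Fin 3 → ℝ) (hx : x ∈ convexHull ℝ {toR3 w0, toR3 w1, toR3 w2, toR3 w3}) : Good K x := by
  refine ⟨_, ⟨![w0, w1, w2, w3], rfl, hd⟩, convexHull_min ?_ hK, hx⟩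
  rintro y (rfl | rfl | rfl | rfl) <;> assumption

lemma toR3_lift3 (w : Fin 2 → ℤ) (h : ℤ) : toR3 (lift3 w h) = ![(w 0 : ℝ), (w 1 : ℝ), (h : ℝ)] := by
  ext i; fin_cases i <;> simp [toR3, lift3]

lemma lem31 (K : Set (Fin 3 → ℝ)) (hK : Convex ℝ K) (h h' : ℤ) (hh : h' - h = 1 ∨ h' - h = -1)
    (w3 : Fin 2 → ℤ) (h3 : toR3 (lift3 w3 h') ∈ K) (x : Fin 3 → ℝ) (n : ℕ) :
    ∀ (w0 w1 w2 : Fin 2 → ℤ),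
    toR3 (lift3 w0 h) ∈ K → toR3 (lift3 w1 h) ∈ K → toR3 (lift3 w2 h) ∈ K →
    D2 (w1 - w0) (w2 - w0) ≠ 0 → |D2 (w1 - w0) (w2 - w0)| ≤ n →
    x ∈ convexHull ℝ {toR3 (lift3 w0 h), toR3 (lift3 w1 h), toR3 (lift3 w2 h), toR3 (lift3 w3 h')} →
    Good K x := by
  induction n with
  | zero =>
    intro w0 w1 w2 _ _ _ hD hn
    exact absurd (abs_nonpos_iff.1 (by simpa using hn)) hD
  | succ n ih =>
    intro w0 w1 w2 h0 h1 h2 hD hn hx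
    have hpos := abs_pos.2 hD
    by_cases hD2 : 2 ≤ |D2 (w1 - w0) (w2 - w0)|
    swap
    · refine good_of_det K hK _ _ _ _ h0 h1 h2 h3 ?_ x hx
      have h1 : |D2 (w1 - w0) (w2 - w0)| = 1 := by omega
      have hdet : (Matrix.of ![lift3 w1 h - lift3 w0 h, lift3 w2 h - lift3 w0 h,
          lift3 w3 h' - lift3 w0 h]).det = D2 (w1 - w0) (w2 - w0) * (h' - h) := by
        simp [Matrix.det_fin_three, lift3, D2]; ring
      rw [hdet]
      rcases hh with e | e <;> rcases eq_or_eq_neg_of_abs_eq h1 with e' | e' <;> rw [e, e'] <;> simp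
    · obtain ⟨c, N, n0, n1, n2, a0, a1, a2, b0, b1, b2, hs, hk⟩ := tri w0 w1 w2 hD2
      have hN : 0 < N := by omega
      have hNR : (0 : ℝ) < N := by exact_mod_cast hN
      have hNne : (N : ℝ) ≠ 0 := hNR.ne'
      have hsR : (n0 : ℝ) + n1 + n2 = N := by exact_mod_cast hs
      have hc : toR3 (lift3 c h) = (n0 / N : ℝ) • toR3 (lift3 w0 h) + (n1 / N : ℝ) • toR3 (lift3 w1 h)
          + (n2 / N : ℝ) • toR3 (lift3 w2 h) + (0 : ℝ) • toR3 (lift3 w3 h') := by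
        have k0 : (N : ℝ) * c 0 = n0 * w0 0 + n1 * w1 0 + n2 * w2 0 := by exact_mod_cast hk 0
        have k1 : (N : ℝ) * c 1 = n0 * w0 1 + n1 * w1 1 + n2 * w2 1 := by exact_mod_cast hk 1
        simp only [toR3_lift3]
        ext i; fin_cases i
        · simp; field_simp; linear_combination k0
        · simp; field_simp; linear_combination k1
        · simp; field_simp; linear_combination -(h : ℝ) * hsR
      have hl : (n0 / N : ℝ) + n1 / N + n2 / N + 0 = 1 := by
        field_simp; linear_combination hsR
      have hcK : toR3 (lift3 c h) ∈ K := by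
        refine convexHull_min (s := {toR3 (lift3 w0 h), toR3 (lift3 w1 h), toR3 (lift3 w2 h),
          toR3 (lift3 w3 h')}) ?_ hK ((hull4 _ _ _ _ _).2 ⟨_, _, _, _, ?_, ?_, ?_, le_rfl, hl, hc⟩)
        · rintro y (rfl | rfl | rfl | rfl) <;> assumption
        · exact div_nonneg (by exact_mod_cast a0) hNR.le
        · exact div_nonneg (by exact_mod_cast a1) hNR.le
        · exact div_nonneg (by exact_mod_cast a2) hNR.le
      have k0 := hk 0
      have k1 := hk 1
      have hdec : ∀ (m d : ℤ), 0 < (m / N : ℝ) → m < N → N * d = m * D2 (w1 - w0) (w2 - w0) →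
          d ≠ 0 ∧ |d| ≤ n := by
        intro m d hm hmN e
        have hm0 : 0 < m := by
          have := (div_pos_iff_of_pos_right hNR).1 hm
          exact_mod_cast this
        have e2 : N * |d| = m * |D2 (w1 - w0) (w2 - w0)| := by
          have := congrArg abs e
          rwa [abs_mul, abs_mul, abs_of_pos hN, abs_of_pos hm0] at this
        refine ⟨?_, ?_⟩
        · rintro rfl
          have : m * |D2 (w1 - w0) (w2 - w0)| = 0 := by rw [← e2]; simp
          have := mul_pos hm0 hpos
          omega
        · have : |d| < |D2 (w1 - w0) (w2 - w0)| := by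
            by_contra hcon
            push Not at hcon
            nlinarith
          push_cast at hn
          omega
      rcases stellar _ _ _ _ _ x _ _ _ _ hl hc hx with ⟨hp, hx⟩ | ⟨hp, hx⟩ | ⟨hp, hx⟩ | ⟨hp, hx⟩
      · obtain ⟨d0, d1⟩ := hdec n0 (D2 (w1 - c) (w2 - c)) hp b0 (by
          simp only [D2, Pi.sub_apply]
          rw [← hs] at k0 k1 ⊢
          linear_combination (w1 1 - w2 1) * k0 + (w2 0 - w1 0) * k1)
        exact ih c w1 w2 hcK h1 h2 d0 d1 hx
      · obtain ⟨d0, d1⟩ := hdec n1 (D2 (c - w0) (w2 - w0)) hp b1 (by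
          simp only [D2, Pi.sub_apply]
          rw [← hs] at k0 k1 ⊢
          linear_combination (w2 1 - w0 1) * k0 + (w0 0 - w2 0) * k1)
        exact ih w0 c w2 h0 hcK h2 d0 d1 hx
      · obtain ⟨d0, d1⟩ := hdec n2 (D2 (w1 - w0) (c - w0)) hp b2 (by
          simp only [D2, Pi.sub_apply]
          rw [← hs] at k0 k1 ⊢
          linear_combination (w0 1 - w1 1) * k0 + (w1 0 - w0 0) * k1)
        exact ih w0 w1 c h0 h1 hcK d0 d1 hx
      · exact absurd hp (lt_irrefl _)

lemma between (K : Set (ℝ × ℝ)) (hK : Convex ℝ K) (q x y A1 A2 B1 B2 : ℝ) (hA : (A1, A2) ∈ K)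
    (hB : (B1, B2) ∈ K) (h0 : ((0 : ℝ), (0 : ℝ)) ∈ K) (hq : (q, (0 : ℝ)) ∈ K) (hq0 : 0 < q)
    (hA1 : A1 ≤ 0) (hB1 : q ≤ B1) (hx : 0 ≤ x) (hxq : x ≤ q) (hy : 0 ≤ y)
    (hl : (B1 - A1) * (y - A2) ≤ (B2 - A2) * (x - A1)) : (x, y) ∈ K := by
  have hS : 0 < B1 - A1 := by linarith
  have m1 : (x, (0 : ℝ)) ∈ K := by
    have := hK h0 hq (a := (q - x) / q) (b := x / q) (div_nonneg (by linarith) hq0.le)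
      (div_nonneg hx hq0.le) (by field_simp; ring)
    convert this using 1
    ext
    · simp; field_simp
    · simp
  obtain ⟨Y, hY⟩ : ∃ Y, Y = (A2 * (B1 - x) + B2 * (x - A1)) / (B1 - A1) := ⟨_, rfl⟩
  have m2 : (x, Y) ∈ K := by
    have := hK hA hB (a := (B1 - x) / (B1 - A1)) (b := (x - A1) / (B1 - A1))
      (div_nonneg (by linarith) hS.le)
      (div_nonneg (by linarith) hS.le) (by field_simp; ring)
    convert this using 1
    ext
    · simp; field_simp; ring
    · simp [hY]; field_simp
  have hyY : y ≤ Y := by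
    rw [hY, le_div_iff₀ hS]; linarith
  rcases eq_or_lt_of_le hy with h | h
  · rw [← h]; exact m1
  · have hYp : 0 < Y := by linarith
    have := hK m1 m2 (a := (Y - y) / Y) (b := y / Y) (div_nonneg (by linarith) hYp.le)
      (div_nonneg hy hYp.le) (by field_simp; ring)
    convert this using 1
    ext
    · simp; field_simp; ring
    · simp; field_simp

lemma line {ι : Type*} (K : Set (ℝ × ℝ)) (hK : Convex ℝ K) (q : ℤ) (hq : 0 < q) (W : Finset ι)
    (x y : ι → ℤ) (hW : ∀ i ∈ W, ((x i : ℝ), (y i : ℝ)) ∈ K) (hs : ∀ i ∈ W, x i ≤ 0 ∨ q ≤ x i)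
    (i0 i1 : ι) (h0 : i0 ∈ W) (h1 : i1 ∈ W) (x0 : x i0 = 0) (y0 : y i0 = 0) (x1 : x i1 = q)
    (y1 : y i1 = 0) :
    ∃ A ∈ W, ∃ B ∈ W, ∃ S R κ : ℤ, 0 < S ∧ S = x B - x A ∧ R = y B - y A ∧ S * y A = R * x A + κ ∧
      S * y B = R * x B + κ ∧ (∀ C ∈ W, S * y C ≤ R * x C + κ) ∧
      ∀ i j : ℤ, 0 ≤ i → i ≤ q → 0 ≤ j → ((i : ℝ), (j : ℝ)) ∉ K → R * i + κ < S * j := by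
  classical
  have hne : ((W.filter (fun i => x i ≤ 0)) ×ˢ (W.filter (fun i => q ≤ x i))).Nonempty :=
    ⟨(i0, i1), by simp [h0, h1, x0, x1]⟩
  obtain ⟨⟨A, B⟩, hAB, hmax⟩ := Finset.exists_max_image _ (fun p : ι × ι =>
    ((y p.1 * (2 * x p.2 - q) + y p.2 * (q - 2 * x p.1) : ℤ) : ℚ) / ((x p.2 - x p.1 : ℤ) : ℚ)) hne
  simp only [Finset.mem_product, Finset.mem_filter] at hAB
  obtain ⟨⟨hA, hxA⟩, hB, hxB⟩ := hAB
  have hS : 0 < x B - x A := by linarith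
  refine ⟨A, hA, B, hB, x B - x A, y B - y A, (x B - x A) * y A - (y B - y A) * x A, hS, rfl, rfl,
    by ring, by ring, ?_, ?_⟩
  · intro C hC
    have hSq : (0 : ℚ) < ((x B - x A : ℤ) : ℚ) := by exact_mod_cast hS
    rcases hs C hC with h | h
    · have := hmax (C, B) (by simp [hC, h, hB, hxB])
      have hS2 : 0 < x B - x C := by linarith
      have hS2q : (0 : ℚ) < ((x B - x C : ℤ) : ℚ) := by exact_mod_cast hS2
      rw [div_le_div_iff₀ hS2q hSq] at this
      norm_cast at this
      by_contra hcon
      push Not at hcon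
      nlinarith [mul_pos (show 0 < 2 * x B - q by linarith) (sub_pos.2 hcon)]
    · have := hmax (A, C) (by simp [hC, h, hA, hxA])
      have hS2 : 0 < x C - x A := by linarith
      have hS2q : (0 : ℚ) < ((x C - x A : ℤ) : ℚ) := by exact_mod_cast hS2
      rw [div_le_div_iff₀ hS2q hSq] at this
      norm_cast at this
      by_contra hcon
      push Not at hcon
      nlinarith [mul_pos (show 0 < q - 2 * x A by linarith) (sub_pos.2 hcon)]
  · intro i j hi hiq hj hK'
    by_contra hcon
    push Not at hcon
    apply hK'
    have hh0 := hW i0 h0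
    have hh1 := hW i1 h1
    rw [x0, y0] at hh0
    rw [x1, y1] at hh1
    refine between K hK q i j (x A) (y A) (x B) (y B) (hW A hA) (hW B hB) (by simpa using hh0)
      (by simpa using hh1) (by exact_mod_cast hq) (by exact_mod_cast hxA) (by exact_mod_cast hxB)
      (by exact_mod_cast hi) (by exact_mod_cast hiq) (by exact_mod_cast hj) ?_
    norm_cast
    linarith

/-- Affine chart with origin `o` and axes `u`, `v`. -/
def chart (o u v : Fin 2 → ℤ) (c d : ℝ) : Fin 2 → ℝ :=
  toR2 o + (c / (D2 u v : ℝ)) • toR2 u + (d / (D2 u v : ℝ)) • toR2 v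

lemma chart_eq (o u v p : Fin 2 → ℤ) (h : 0 < D2 u v) :
    chart o u v (D2 (p - o) v : ℝ) (D2 u (p - o) : ℝ) = toR2 p := by
  have h' : (D2 u v : ℝ) ≠ 0 := by exact_mod_cast h.ne'
  have e : (D2 u v : ℝ) = u 0 * v 1 - u 1 * v 0 := by simp [D2]
  ext i
  simp only [chart, Pi.add_apply, Pi.smul_apply, smul_eq_mul, toR2]
  field_simp
  rw [e]
  fin_cases i
  · simp [D2]; ring
  · simp [D2]; ring

lemma chart_convex (Q : Set (Fin 2 → ℝ)) (hQ : Convex ℝ Q) (o u v : Fin 2 → ℤ) :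
    Convex ℝ {c : ℝ × ℝ | chart o u v c.1 c.2 ∈ Q} := by
  intro c hc d hd a b ha hb hab
  have := hQ hc hd ha hb hab
  simp only [Set.mem_ofPred_eq]
  convert this using 1
  ext i
  simp only [chart, Pi.add_apply, Pi.smul_apply, smul_eq_mul, Prod.fst_add, Prod.snd_add,
    Prod.smul_fst, Prod.smul_snd]
  linear_combination -(toR2 o i) * hab

lemma chart_convex' (Q : Set (Fin 2 → ℝ)) (hQ : Convex ℝ Q) (o u v : Fin 2 → ℤ) :
    Convex ℝ {c : ℝ × ℝ | chart o u v c.2 c.1 ∈ Q} := by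
  intro c hc d hd a b ha hb hab
  have := hQ hc hd ha hb hab
  simp only [Set.mem_ofPred_eq]
  convert this using 1
  ext i
  simp only [chart, Pi.add_apply, Pi.smul_apply, smul_eq_mul, Prod.fst_add, Prod.snd_add,
    Prod.smul_fst, Prod.smul_snd]
  linear_combination -(toR2 o i) * hab

lemma rightLine (Q : Set (Fin 2 → ℝ)) (hQ : Convex ℝ Q) (W : Finset (Fin 2 → ℤ))
    (hW : ∀ p ∈ W, toR2 p ∈ Q) (b0 b1 u v z : Fin 2 → ℤ) (h0 : b0 ∈ W) (h1 : b1 ∈ W)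
    (hv : v = b1 - b0) (q ζ : ℤ) (hq : D2 u v = q) (hz : D2 u z = 1) (hζ : D2 z v = ζ)
    (hζ0 : 0 < ζ) (hζq : ζ < q) (hs : ∀ p ∈ W, D2 u (p - b0) ≤ 0 ∨ q ≤ D2 u (p - b0))
    (hz1 : toR2 (b0 + z) ∉ Q) (hz2 : toR2 (b1 + u - z) ∉ Q) :
    ∃ t k : ℝ, (∀ C ∈ W, (D2 (C - b0) v : ℝ) ≤ t * D2 u (C - b0) + k) ∧ t + k < ζ ∧
      t * (q - 1) + k < q - ζ ∧ 0 ≤ k ∧ 0 ≤ t * q + k := by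
  have hqp : 0 < D2 u v := by omega
  obtain ⟨A, hA, B, hB, S, R, κ, hS, -, -, -, -, hC, hK⟩ := line {c : ℝ × ℝ | chart b0 u v c.2 c.1 ∈ Q}
    (chart_convex' Q hQ b0 u v) q (by omega) W (fun p => D2 u (p - b0)) (fun p => D2 (p - b0) v)
    (by intro p hp; simp only [Set.mem_ofPred_eq]; rw [chart_eq _ _ _ _ hqp]; exact hW p hp) hs
    b0 b1 h0 h1 (by simp [D2]) (by simp [D2]) (by rw [← hv]; exact hq)
    (by simp [hv, D2]; ring)
  have hSR : (0 : ℝ) < S := by exact_mod_cast hS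
  have e1 := hK 1 ζ (by omega) (by omega) (by omega) (by
    intro hcon
    apply hz1
    rw [← chart_eq b0 u v _ hqp]
    simpa [hz, hζ] using hcon)
  have e2 := hK (q - 1) (q - ζ) (by omega) (by omega) (by omega) (by
    intro hcon
    apply hz2
    rw [← chart_eq b0 u v _ hqp]
    have f1 : D2 (b1 + u - z - b0) v = q - ζ := by
      rw [← hq, ← hζ, hv]; simp [D2]; ring
    have f2 : D2 u (b1 + u - z - b0) = q - 1 := by
      rw [← hq, ← hz, hv]; simp [D2]; ring
    rw [f1, f2]
    exact hcon)
  have c0 := hC b0 h0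
  have c1 := hC b1 h1
  have g1 : D2 (b1 - b0) v = 0 := by rw [hv]; simp [D2]; ring
  have g2 : D2 u (b1 - b0) = q := by rw [← hv, hq]
  have g3 : D2 u (b0 - b0) = 0 := by simp [D2]
  have g4 : D2 (b0 - b0) v = 0 := by simp [D2]
  simp only [g1, g2] at c1
  simp only [g3, g4] at c0
  refine ⟨R / S, κ / S, ?_, ?_, ?_, ?_, ?_⟩
  · intro C hCW
    have := hC C hCW
    have : (S : ℝ) * D2 (C - b0) v ≤ R * D2 u (C - b0) + κ := by exact_mod_cast this
    have h : (R / S : ℝ) * D2 u (C - b0) + κ / S = (R * D2 u (C - b0) + κ) / S := by ring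
    rw [h, le_div_iff₀ hSR]; linarith
  · have : (R : ℝ) * 1 + κ < S * ζ := by exact_mod_cast e1
    rw [← add_div, div_lt_iff₀ hSR]; linarith
  · have : (R : ℝ) * (q - 1) + κ < S * (q - ζ) := by exact_mod_cast e2
    have h : (R / S : ℝ) * (q - 1) + κ / S = (R * (q - 1) + κ) / S := by ring
    rw [h, div_lt_iff₀ hSR]; linarith
  · have : (0 : ℝ) ≤ κ := by
      have : 0 ≤ κ := by linarith
      exact_mod_cast this
    exact div_nonneg this hSR.le
  · have : (0 : ℝ) ≤ R * q + κ := by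
      have : 0 ≤ R * q + κ := by linarith
      exact_mod_cast this
    have h : (R / S : ℝ) * q + κ / S = (R * q + κ) / S := by ring
    rw [h]
    exact div_nonneg this hSR.le

lemma minkowski (P Q : Set (Fin 2 → ℝ)) (hPQ : IsWeakMinkowskiSummand P Q)
    (W : Finset (Fin 2 → ℤ)) (hWne : W.Nonempty) (hQ : Q = convexHull ℝ (toR2 '' ↑W))
    (n : (Fin 2 → ℝ) →ₗ[ℝ] ℝ) (A B : Fin 2 → ℝ) (hA : A ∈ P) (hB : B ∈ P) (hAB : A ≠ B)
    (hmax : ∀ p ∈ P, n p ≤ n A) (hnB : n B = n A) :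
    ∃ C ∈ W, ∃ D ∈ W, C ≠ D ∧ n (toR2 C) = n (toR2 D) ∧ ∀ E ∈ W, n (toR2 E) ≤ n (toR2 C) := by
  obtain ⟨P', ⟨V', hV'ne, hV'⟩, k, hk, hsum⟩ := hPQ
  obtain ⟨C, hC, hCmax⟩ := Finset.exists_max_image W (fun p => n (toR2 p)) hWne
  obtain ⟨c', hc', hc'max⟩ := Finset.exists_max_image V' (fun p => n p) hV'ne
  by_contra hcon
  push Not at hcon
  have huniq : ∀ D ∈ W, n (toR2 D) = n (toR2 C) → D = C := by
    intro D hD e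
    by_contra hne
    obtain ⟨E, hE, hE2⟩ := hcon C hC D hD (Ne.symm hne) e.symm
    exact absurd (hCmax E hE) (not_le.2 hE2)
  have hc'P : c' ∈ P' := by rw [hV']; exact subset_convexHull _ _ hc'
  have hP'max : ∀ p ∈ P', n p ≤ n c' := by
    intro p hp
    rw [hV'] at hp
    exact convexHull_min (t := {p | n p ≤ n c'}) (fun p hp => hc'max p hp)
      (convex_halfSpace_le n.isLinear _) hp
  have hcv : Convex ℝ {p | n p < n (toR2 C) ∨ p = toR2 C} := by
    rintro x hx y hy a b ha hb hab
    rcases hx with hx | rfl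
    · rcases hy with hy | rfl
      · exact Or.inl (convex_halfSpace_lt n.isLinear _ hx hy ha hb hab)
      · rcases eq_or_lt_of_le ha with h | h
        · right
          have : b = 1 := by linarith
          rw [← h, this]; simp
        · left
          simp only [map_add, map_smul, smul_eq_mul]
          have : b = 1 - a := by linarith
          rw [this]; nlinarith
    · rcases hy with hy | rfl
      · rcases eq_or_lt_of_le hb with h | h
        · right
          have : a = 1 := by linarith
          rw [← h, this]; simp
        · left
          simp only [map_add, map_smul, smul_eq_mul]
          have : a = 1 - b := by linarith
          rw [this]; nlinarith
      · right
        rw [← add_smul, hab, one_smul]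
  have hQsub : ∀ x ∈ Q, n x < n (toR2 C) ∨ x = toR2 C := by
    intro x hx
    rw [hQ] at hx
    refine convexHull_min ?_ hcv hx
    rintro _ ⟨D, hD, rfl⟩
    rcases eq_or_lt_of_le (hCmax D hD) with h | h
    · right; rw [huniq D hD h]
    · left; exact h
  have hCQ : toR2 C ∈ Q := by
    rw [hQ]; exact subset_convexHull _ _ ⟨C, hC, rfl⟩
  have hkey : ∀ X ∈ P, n X = n A → X + c' = k • toR2 C := by
    intro X hX hnX
    have h1 : X + c' ∈ k • Q := by rw [← hsum]; exact Set.add_mem_add hX hc'P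
    obtain ⟨x, hx, hxe⟩ := h1
    simp only at hxe
    have h2 : k • toR2 C ∈ P + P' := by rw [hsum]; exact Set.smul_mem_smul_set hCQ
    obtain ⟨p, hp, p', hp', hpe⟩ := h2
    simp only at hpe
    rcases hQsub x hx with h | h
    · exfalso
      have e1 := congrArg n hxe
      have e2 := congrArg n hpe
      simp only [map_add, map_smul, smul_eq_mul] at e1 e2
      have := hmax p hp
      have := hP'max p' hp'
      nlinarith
    · rw [← hxe, h]
  have := (hkey A hA rfl).trans (hkey B hB hnB).symm
  exact hAB (add_right_cancel this)

lemma topEdge (P Q : Set (Fin 2 → ℝ)) (hPQ : IsWeakMinkowskiSummand P Q)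
    (V W : Finset (Fin 2 → ℤ)) (hP : P = convexHull ℝ (toR2 '' ↑V)) (hWne : W.Nonempty)
    (hQ : Q = convexHull ℝ (toR2 '' ↑W))
    (a0 a1 u v z : Fin 2 → ℤ) (h0 : a0 ∈ V) (h1 : a1 ∈ V)
    (hu : u = a1 - a0) (q ζ : ℤ) (hq : D2 u v = q) (hz : D2 u z = 1) (hζ : D2 z v = ζ)
    (hζ0 : 0 < ζ) (hζq : ζ < q) (hs : ∀ p ∈ V, D2 (p - a0) v ≤ 0 ∨ q ≤ D2 (p - a0) v)
    (hz1 : toR2 (a0 + z) ∉ P) :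
    ∃ C ∈ W, ∃ D ∈ W, ∃ s r : ℤ, s = D2 (D - C) v ∧ r = D2 u (D - C) ∧ 0 < s ∧ r * ζ + q ≤ s ∧
      r * (ζ - q) + q ≤ s ∧ ∀ E ∈ W, s * D2 u E - r * D2 E v ≤ s * D2 u C - r * D2 C v := by
  have hqp : 0 < D2 u v := by omega
  have hPc : Convex ℝ P := by rw [hP]; exact convex_convexHull _ _
  have hV : ∀ p ∈ V, toR2 p ∈ P := by
    intro p hp; rw [hP]; exact subset_convexHull _ _ ⟨p, hp, rfl⟩
  obtain ⟨A, hA, B, hB, S, R, κ, hS, hSe, hRe, hAe, hBe, hC, hK⟩ :=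
    line {c : ℝ × ℝ | chart a0 u v c.1 c.2 ∈ P}
    (chart_convex P hPc a0 u v) q (by omega) V (fun p => D2 (p - a0) v) (fun p => D2 u (p - a0))
    (by intro p hp; simp only [Set.mem_ofPred_eq]; rw [chart_eq _ _ _ _ hqp]; exact hV p hp) hs
    a0 a1 h0 h1 (by simp [D2]) (by simp [D2]) (by rw [← hu]; exact hq)
    (by simp [hu, D2]; ring)
  have e1 := hK ζ 1 (by omega) (by omega) (by omega) (by
    intro hcon
    apply hz1
    rw [← chart_eq a0 u v _ hqp]
    simpa [hz, hζ] using hcon)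
  have c0 := hC a0 h0
  have c1 := hC a1 h1
  have g1 : D2 u (a1 - a0) = 0 := by rw [hu]; simp [D2]; ring
  have g2 : D2 (a1 - a0) v = q := by rw [← hu, hq]
  have g3 : D2 u (a0 - a0) = 0 := by simp [D2]
  have g4 : D2 (a0 - a0) v = 0 := by simp [D2]
  simp only [g1, g2] at c1
  simp only [g3, g4] at c0
  have f1 : R * ζ < S := by linarith
  have f2 : R * (ζ - q) < S := by linarith
  let n : (Fin 2 → ℝ) →ₗ[ℝ] ℝ :=
    ((-S * u 1 - R * v 1 : ℤ) : ℝ) • LinearMap.proj 0 + ((S * u 0 + R * v 0 : ℤ) : ℝ) • LinearMap.proj 1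
  have hn : ∀ p : Fin 2 → ℤ, n (toR2 p) = ((S * D2 u p - R * D2 p v : ℤ) : ℝ) := by
    intro p
    simp [n, toR2, D2]; ring
  have hnle : ∀ p ∈ V, n (toR2 p) ≤ n (toR2 A) := by
    intro p hp
    rw [hn, hn]
    have := hC p hp
    have h3 : S * D2 u p - R * D2 p v ≤ S * D2 u A - R * D2 A v := by
      simp [D2] at this hAe ⊢
      linarith
    exact_mod_cast h3
  obtain ⟨C, hCW, D, hDW, hne, hnCD, hmaxC⟩ := minkowski P Q hPQ W hWne hQ n (toR2 A) (toR2 B)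
    (hV A hA) (hV B hB) (by
      intro h
      have : A = B := by
        ext i; have := congrFun h i; simp [toR2] at this; exact this
      rw [this] at hSe; omega) (by
      intro p hp
      rw [hP] at hp
      refine convexHull_min (t := {p | n p ≤ n (toR2 A)}) ?_ (convex_halfSpace_le n.isLinear _) hp
      rintro _ ⟨p, hp, rfl⟩
      exact hnle p hp) (by
      rw [hn, hn]
      have h3 : S * D2 u B - R * D2 B v = S * D2 u A - R * D2 A v := by
        simp [D2] at hAe hBe ⊢
        linarith
      exact_mod_cast h3)
  have main : ∀ C ∈ W, ∀ D ∈ W, n (toR2 C) = n (toR2 D) → (∀ E ∈ W, n (toR2 E) ≤ n (toR2 C)) →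
      0 < D2 (D - C) v → ∃ C ∈ W, ∃ D ∈ W, ∃ s r : ℤ, s = D2 (D - C) v ∧ r = D2 u (D - C) ∧
        0 < s ∧ r * ζ + q ≤ s ∧
      r * (ζ - q) + q ≤ s ∧ ∀ E ∈ W, s * D2 u E - r * D2 E v ≤ s * D2 u C - r * D2 C v := by
    intro C hC D hD hnCD hmax hpos
    obtain ⟨s, hs⟩ : ∃ s, s = D2 (D - C) v := ⟨_, rfl⟩
    obtain ⟨r, hr⟩ : ∃ r, r = D2 u (D - C) := ⟨_, rfl⟩
    obtain ⟨α, hα⟩ : ∃ α, α = D2 (D - C) z := ⟨_, rfl⟩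
    have hsr : S * r = R * s := by
      rw [hn, hn] at hnCD
      norm_cast at hnCD
      rw [hs, hr]
      simp [D2] at hnCD ⊢
      linarith
    have hlat : s = r * ζ + q * α := by
      rw [hs, hr, hα, ← hq, ← hζ]
      linear_combination (norm := skip) (-D2 (D - C) v) * hz
      simp only [D2, Pi.sub_apply]; ring
    rw [← hs] at hpos
    have p1 : 0 < s - r * ζ := by
      have : 0 < S * (s - r * ζ) := by nlinarith [mul_pos hpos (sub_pos.2 f1)]
      exact pos_of_mul_pos_right this hS.le
    have p2 : 0 < s - r * (ζ - q) := by
      have : 0 < S * (s - r * (ζ - q)) := by nlinarith [mul_pos hpos (sub_pos.2 f2)]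
      exact pos_of_mul_pos_right this hS.le
    have q1 : 0 < α := by
      have : 0 < q * α := by linarith
      exact pos_of_mul_pos_right this (by omega)
    have q2 : 0 < α + r := by
      have : 0 < q * (α + r) := by linarith
      exact pos_of_mul_pos_right this (by omega)
    have hq0 : 0 < q := by omega
    refine ⟨C, hC, D, hD, s, r, hs, hr, hpos, by nlinarith, by nlinarith, ?_⟩
    intro E hE
    have := hmax E hE
    rw [hn, hn] at this
    norm_cast at this
    have h4 : S * (s * D2 u E - r * D2 E v) ≤ S * (s * D2 u C - r * D2 C v) := by
      have := mul_le_mul_of_nonneg_left this hpos.le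
      linear_combination this + (D2 C v - D2 E v) * hsr
    exact le_of_mul_le_mul_left h4 hS
  rcases lt_trichotomy (D2 (D - C) v) 0 with h | h | h
  · refine main D hDW C hCW hnCD.symm (fun E hE => hnCD ▸ hmaxC E hE) ?_
    simp only [D2, Pi.sub_apply] at h ⊢; linarith
  · exfalso
    rw [hn, hn] at hnCD
    norm_cast at hnCD
    have hr : S * D2 u (D - C) = 0 := by
      have : S * D2 u (D - C) = R * D2 (D - C) v := by
        simp [D2] at hnCD ⊢
        linarith
      rw [this, h, mul_zero]
    have hr : D2 u (D - C) = 0 := by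
      rcases mul_eq_zero.1 hr with h | h
      · omega
      · exact h
    apply hne
    have i0 : D2 u v * (D 0 - C 0) = 0 := by
      have : D2 u v * (D 0 - C 0) = D2 (D - C) v * u 0 + D2 u (D - C) * v 0 := by simp [D2]; ring
      rw [this, h, hr]; ring
    have i1 : D2 u v * (D 1 - C 1) = 0 := by
      have : D2 u v * (D 1 - C 1) = D2 (D - C) v * u 1 + D2 u (D - C) * v 1 := by simp [D2]; ring
      rw [this, h, hr]; ring
    have j0 := (mul_eq_zero.1 i0).resolve_left hqp.ne'
    have j1 := (mul_eq_zero.1 i1).resolve_left hqp.ne'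
    ext i; fin_cases i
    · simp; linarith
    · simp; linarith
  · exact main C hCW D hDW hnCD hmaxC h

lemma final1 (q ζ t k t' k' X Y s r : ℝ) (hζ : 1 ≤ ζ) (hζq : ζ ≤ q - 1)
    (h1 : t + k < ζ) (h2 : t * (q - 1) + k < q - ζ) (h3 : 0 ≤ k) (h4 : 0 ≤ t * q + k)
    (h1' : t' + k' < ζ) (h2' : t' * (q - 1) + k' < q - ζ) (h3' : 0 ≤ k') (h4' : 0 ≤ t' * q + k')
    (hY : Y ≤ 0 ∨ q ≤ Y) (hl : -X ≤ t' * (q - Y) + k') (hr0 : X ≤ t * Y + k)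
    (hr : X + s ≤ t * (Y + r) + k)
    (s0 : 0 < s) (s1 : r * ζ + q ≤ s) (s2 : r * (ζ - q) + q ≤ s) (hm : s * q ≤ s * Y - r * X) :
    q ≤ Y ∧ q ≤ t * Y + k + (t' * (q - Y) + k') := by
  have ht : t < ζ := by linarith
  have ht2 : ζ - q < t := by linarith
  have ht' : t' < ζ := by linarith
  have hst : q ≤ s - t * r := by
    rcases le_total 0 r with h | h
    · nlinarith
    · nlinarith
  refine ⟨?_, by linarith⟩
  rcases hY with hY | hY
  swap
  · exact hY
  exfalso
  have hYq : Y - q < 0 := by linarith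
  rcases le_total 0 r with h | h
  · -- X is at least -q + ζ Y
    have hX : -q + ζ * Y ≤ X := by
      have : t' * (1 - Y) ≤ ζ * (1 - Y) := mul_le_mul_of_nonneg_right ht'.le (by linarith)
      nlinarith
    have a1 : r * (-q + ζ * Y) ≤ r * X := mul_le_mul_of_nonneg_left hX h
    have a2 : s * (Y - q) ≤ (r * ζ + q) * (Y - q) := mul_le_mul_of_nonpos_right s1 hYq.le
    have a3 : r * q * 1 ≤ r * q * ζ := mul_le_mul_of_nonneg_left hζ (mul_nonneg h (by linarith))
    have a4 : q * (Y - q) < 0 := mul_neg_of_pos_of_neg (by linarith) hYq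
    linarith
  · have hX : X ≤ q - (q - ζ) * Y := by
      have : -t * (1 - Y) ≤ (q - ζ) * (1 - Y) := mul_le_mul_of_nonneg_right (by linarith) (by linarith)
      nlinarith
    have a1 : (-r) * X ≤ (-r) * (q - (q - ζ) * Y) := mul_le_mul_of_nonneg_left hX (by linarith)
    have a2 : s * (Y - q) ≤ (r * (ζ - q) + q) * (Y - q) := mul_le_mul_of_nonpos_right s2 hYq.le
    have a3 : (-r) * q * 1 ≤ (-r) * q * (q - ζ) :=
      mul_le_mul_of_nonneg_left (by linarith) (mul_nonneg (by linarith) (by linarith))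
    have a4 : q * (Y - q) < 0 := mul_neg_of_pos_of_neg (by linarith) hYq
    linarith

lemma half (P Q : Set (Fin 2 → ℝ)) (hPQ : IsWeakMinkowskiSummand P Q)
    (V W : Finset (Fin 2 → ℤ)) (hP : P = convexHull ℝ (toR2 '' ↑V))
    (hQ : Q = convexHull ℝ (toR2 '' ↑W))
    (a0 a1 b0 b1 u v z : Fin 2 → ℤ) (h0 : a0 ∈ V) (h1 : a1 ∈ V) (k1 : b1 ∈ W)
    (hu : u = a1 - a0) (hv : v = b1 - b0)
    (q ζ : ℤ) (hq : D2 u v = q) (hz : D2 u z = 1) (hζ : D2 z v = ζ)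
    (hζ0 : 0 < ζ) (hζq : ζ < q) (hs : ∀ p ∈ V, D2 (p - a0) v ≤ 0 ∨ q ≤ D2 (p - a0) v)
    (hsQ : ∀ p ∈ W, D2 u (p - b0) ≤ 0 ∨ q ≤ D2 u (p - b0))
    (hz1 : toR2 (a0 + z) ∉ P) (t k t' k' : ℝ)
    (hl : ∀ C ∈ W, (D2 (C - b0) v : ℝ) ≤ t * D2 u (C - b0) + k)
    (hl' : ∀ C ∈ W, -(D2 (C - b0) v : ℝ) ≤ t' * (q - D2 u (C - b0)) + k')
    (e1 : t + k < ζ) (e2 : t * (q - 1) + k < q - ζ) (e3 : 0 ≤ k) (e4 : 0 ≤ t * q + k)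
    (e1' : t' + k' < ζ) (e2' : t' * (q - 1) + k' < q - ζ) (e3' : 0 ≤ k') (e4' : 0 ≤ t' * q + k') :
    ∃ Y : ℝ, q ≤ Y ∧ q ≤ t * Y + k + (t' * (q - Y) + k') := by
  obtain ⟨C, hC, D, hD, s, r, hse, hre, s0, s1, s2, hm⟩ := topEdge P Q hPQ V W hP ⟨b1, k1⟩ hQ a0 a1
    u v z h0 h1 hu q ζ hq hz hζ hζ0 hζq hs hz1
  have hm := hm b1 k1
  refine ⟨D2 u (C - b0), final1 q ζ t k t' k' (D2 (C - b0) v) (D2 u (C - b0)) s r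
    (by exact_mod_cast hζ0) (by have : ζ ≤ q - 1 := by omega
                                exact_mod_cast this) e1 e2 e3 e4 e1' e2' e3' e4'
    (by have := hsQ C hC; exact_mod_cast this) (hl' C hC) (hl C hC) ?_ (by exact_mod_cast s0)
    (by exact_mod_cast s1) (by exact_mod_cast s2) ?_⟩
  · have := hl D hD
    have f1 : D2 (D - b0) v = D2 (C - b0) v + s := by rw [hse]; simp [D2]; ring
    have f2 : D2 u (D - b0) = D2 u (C - b0) + r := by rw [hre]; simp [D2]; ring
    rw [f1, f2] at this
    exact_mod_cast this
  · have h : s * q ≤ s * D2 u (C - b0) - r * D2 (C - b0) v := by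
      have f1 : D2 u (C - b0) = D2 u C - D2 u b1 + q := by rw [← hq, hv]; simp [D2]; ring
      have f2 : D2 (C - b0) v = D2 C v - D2 b1 v := by rw [hv]; simp [D2]; ring
      rw [f1, f2]
      linarith
    exact_mod_cast h

lemma claim (P Q : Set (Fin 2 → ℝ)) (hPQ : IsWeakMinkowskiSummand P Q)
    (hP : IsLatticePolytope2 P) (hQ : IsLatticePolytope2 Q)
    (a0 a1 b0 b1 : Fin 2 → ℤ) (h0 : toR2 a0 ∈ P) (h1 : toR2 a1 ∈ P) (k0 : toR2 b0 ∈ Q)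
    (k1 : toR2 b1 ∈ Q) (hD : 2 ≤ D2 (a1 - a0) (b1 - b0)) :
    (∃ c, toR2 c ∈ P ∧ 0 < D2 (c - a0) (b1 - b0) ∧ D2 (c - a0) (b1 - b0) < D2 (a1 - a0) (b1 - b0)) ∨
    (∃ d, toR2 d ∈ Q ∧ 0 < D2 (a1 - a0) (d - b0) ∧ D2 (a1 - a0) (d - b0) < D2 (a1 - a0) (b1 - b0)) := by
  classical
  by_contra hcon
  push Not at hcon
  obtain ⟨hc, hd⟩ := hcon
  obtain ⟨u, hu⟩ : ∃ u, u = a1 - a0 := ⟨_, rfl⟩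
  obtain ⟨v, hv⟩ : ∃ v, v = b1 - b0 := ⟨_, rfl⟩
  obtain ⟨q, hq⟩ : ∃ q, D2 u v = q := ⟨_, rfl⟩
  rw [← hu, ← hv, hq] at hD hc hd
  obtain ⟨V0, -, hV0⟩ := hP
  obtain ⟨W0, -, hW0⟩ := hQ
  have hPc : Convex ℝ P := by rw [hV0]; exact convex_convexHull _ _
  have hQc : Convex ℝ Q := by rw [hW0]; exact convex_convexHull _ _
  have ext2 : ∀ (P : Set (Fin 2 → ℝ)) (V0 : Finset (Fin 2 → ℤ)) (a0 a1 : Fin 2 → ℤ),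
      P = convexHull ℝ (toR2 '' ↑V0) → toR2 a0 ∈ P → toR2 a1 ∈ P →
      P = convexHull ℝ (toR2 '' ↑(insert a0 (insert a1 V0))) := by
    intro P V0 a0 a1 hP h0 h1
    apply Set.Subset.antisymm
    · rw [hP]
      apply convexHull_mono
      apply Set.image_mono
      intro p hp
      simp [hp]
    · refine convexHull_min ?_ (by rw [hP]; exact convex_convexHull _ _)
      rintro _ ⟨p, hp, rfl⟩
      simp at hp
      rcases hp with rfl | rfl | hp
      · exact h0
      · exact h1
      · rw [hP]; exact subset_convexHull _ _ ⟨p, hp, rfl⟩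
  have hV := ext2 P V0 a0 a1 hV0 h0 h1
  have hW := ext2 Q W0 b0 b1 hW0 k0 k1
  obtain ⟨V, hVe⟩ : ∃ V, V = insert a0 (insert a1 V0) := ⟨_, rfl⟩
  obtain ⟨W, hWe⟩ : ∃ W, W = insert b0 (insert b1 W0) := ⟨_, rfl⟩
  rw [← hVe] at hV
  rw [← hWe] at hW
  have a0V : a0 ∈ V := by simp [hVe]
  have a1V : a1 ∈ V := by simp [hVe]
  have b0W : b0 ∈ W := by simp [hWe]
  have b1W : b1 ∈ W := by simp [hWe]
  have hVP : ∀ p ∈ V, toR2 p ∈ P := by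
    intro p hp; rw [hV]; exact subset_convexHull _ _ ⟨p, hp, rfl⟩
  have hWQ : ∀ p ∈ W, toR2 p ∈ Q := by
    intro p hp; rw [hW]; exact subset_convexHull _ _ ⟨p, hp, rfl⟩
  have hsP : ∀ p ∈ V, D2 (p - a0) v ≤ 0 ∨ q ≤ D2 (p - a0) v := by
    intro p hp
    by_contra hcon
    push Not at hcon
    have := hc p (hVP p hp) hcon.1
    omega
  have hsQ : ∀ p ∈ W, D2 u (p - b0) ≤ 0 ∨ q ≤ D2 u (p - b0) := by
    intro p hp
    by_contra hcon
    push Not at hcon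
    have := hd p (hWQ p hp) hcon.1
    omega
  -- `u` is primitive
  have hgcd : Int.gcd (u 0) (u 1) = 1 := by
    by_contra hg
    obtain ⟨g, w, hg2, hw⟩ := exists_div u (by rintro h; rw [h] at hq; simp [D2] at hq; omega) hg
    have hgR : (2 : ℝ) ≤ g := by exact_mod_cast hg2
    have hmem : toR2 (a0 + w) ∈ P := by
      have := hPc h0 h1 (a := ((g : ℝ) - 1) / g) (b := 1 / g)
        (div_nonneg (by linarith) (by linarith)) (by positivity) (by field_simp; ring)
      convert this using 1
      ext i
      have e := congrFun (hu.symm.trans hw) i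
      simp at e
      have e : (a1 i : ℝ) - a0 i = g * w i := by exact_mod_cast e
      simp [toR2]; field_simp; linear_combination -e
    have e1 : q = g * D2 w v := by rw [← hq, hw]; simp [D2]; ring
    have e2 : 0 < D2 w v := by
      have : 0 < g * D2 w v := by omega
      exact pos_of_mul_pos_right this (by omega)
    have := hc _ hmem (by simpa using e2)
    simp at this
    nlinarith
  obtain ⟨z, hz, hz0, hzq⟩ := exists_z u v (by omega) hgcd
  obtain ⟨ζ, hζ⟩ : ∃ ζ, D2 z v = ζ := ⟨_, rfl⟩
  rw [hζ] at hz0 hzq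
  rw [hq] at hzq
  have hζ0 : 0 < ζ := by
    rcases eq_or_lt_of_le hz0 with h | h
    swap
    · exact h
    exfalso
    have hqR : (2 : ℝ) ≤ q := by exact_mod_cast hD
    rw [← h] at hζ
    have hvz : ∀ i, v i = q * z i := by
      intro i
      have : v i * D2 u z = D2 u v * z i - D2 z v * u i := by
        fin_cases i
        · simp [D2]; ring
        · simp [D2]; ring
      rw [hz, hζ, hq] at this
      linarith
    have hmem : toR2 (b0 + z) ∈ Q := by
      have := hQc k0 k1 (a := ((q : ℝ) - 1) / q) (b := 1 / q)
        (div_nonneg (by linarith) (by linarith)) (by positivity) (by field_simp; ring)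
      convert this using 1
      ext i
      have e := hvz i
      rw [hv] at e
      simp at e
      have e : (b1 i : ℝ) - b0 i = q * z i := by exact_mod_cast e
      simp [toR2]; field_simp; linear_combination -e
    have := hd _ hmem (by simp [hz])
    simp [hz] at this
    omega
  have nP1 : toR2 (a0 + z) ∉ P := by
    intro h
    have := hc _ h (by simpa [hζ] using hζ0)
    simp [hζ] at this
    omega
  have nP2 : toR2 (a1 + -z) ∉ P := by
    intro h
    have e : D2 (a1 + -z - a0) v = q - ζ := by rw [← hq, ← hζ, hu]; simp [D2]; ring
    have := hc _ h (by omega)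
    omega
  have nQ : ∀ d, D2 u (d - b0) = 1 ∨ D2 u (d - b0) = q - 1 → toR2 d ∉ Q := by
    intro d h h'
    have := hd d h' (by omega)
    omega
  have hq' : D2 (-u) (-v) = q := by rw [← hq]; simp [D2]
  have hz' : D2 (-u) (-z) = 1 := by rw [← hz]; simp [D2]
  have hζ' : D2 (-z) (-v) = ζ := by rw [← hζ]; simp [D2]
  have hY' : ∀ p, D2 (-u) (p - b1) = q - D2 u (p - b0) := by
    intro p; rw [← hq, hv]; simp [D2]; ring
  have hX' : ∀ p, D2 (p - b1) (-v) = - D2 (p - b0) v := by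
    intro p; rw [hv]; simp [D2]; ring
  have hXa : ∀ p, D2 (p - a1) (-v) = q - D2 (p - a0) v := by
    intro p; rw [← hq, hu]; simp [D2]; ring
  have hsQ' : ∀ p ∈ W, D2 (-u) (p - b1) ≤ 0 ∨ q ≤ D2 (-u) (p - b1) := by
    intro p hp; rw [hY']; have := hsQ p hp; omega
  have hsP' : ∀ p ∈ V, D2 (p - a1) (-v) ≤ 0 ∨ q ≤ D2 (p - a1) (-v) := by
    intro p hp; rw [hXa]; have := hsP p hp; omega
  have hv' : -v = b0 - b1 := by rw [hv]; simp
  have hu' : -u = a0 - a1 := by rw [hu]; simp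
  obtain ⟨t, k, hl, e1, e2, e3, e4⟩ := rightLine Q hQc W hWQ b0 b1 u v z b0W b1W hv q ζ hq hz hζ hζ0
    hzq hsQ (nQ _ (by left; simpa using hz))
    (nQ _ (by right; rw [← hq, ← hz, hv]; simp [D2]; ring))
  obtain ⟨t', k', hl', e1', e2', e3', e4'⟩ := rightLine Q hQc W hWQ b1 b0 (-u) (-v) (-z) b1W b0W hv'
    q ζ hq' hz' hζ' hζ0
    hzq hsQ' (nQ _ (by right; rw [← hq, ← hz, hv]; simp [D2]; ring))
    (nQ _ (by left; rw [← hz]; simp [D2]; ring))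
  obtain ⟨Y, hY1, hY2⟩ := half P Q hPQ V W hV hW a0 a1 b0 b1 u v z a0V a1V b1W hu hv q ζ hq hz hζ
    hζ0 hzq hsP hsQ nP1 t k t' k' hl (by
      intro C hC
      have := hl' C hC
      rw [hX', hY'] at this
      push_cast at this
      exact this) e1 e2 e3 e4 e1' e2' e3' e4'
  obtain ⟨Z, hZ1, hZ2⟩ := half P Q hPQ V W hV hW a1 a0 b1 b0 (-u) (-v) (-z) a1V a0V b0W hu' hv' q ζ
    hq' hz' hζ' hζ0 hzq hsP' hsQ' nP2 t' k' t k hl' (by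
      intro C hC
      have := hl C hC
      rw [hX', hY']
      push_cast
      rw [neg_neg, sub_sub_cancel]
      exact this) e1' e2' e3' e4' e1 e2 e3 e4
  have hqR : (2 : ℝ) ≤ q := by exact_mod_cast hD
  rcases le_total t t' with h | h
  · nlinarith
  · nlinarith

lemma mem_cay (P Q : Set (Fin 2 → ℝ)) (hP : Convex ℝ P) (hQ : Convex ℝ Q) (hPn : P.Nonempty)
    (hQn : Q.Nonempty) (x : Fin 3 → ℝ) (hx : x ∈ cay P Q) :
    ∃ t : ℝ, 0 ≤ t ∧ t ≤ 1 ∧ ∃ p ∈ P, ∃ q ∈ Q,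
      x = ![(1 - t) * p 0 + t * q 0, (1 - t) * p 1 + t * q 1, t] := by
  refine convexHull_min (t := {x | ∃ t : ℝ, 0 ≤ t ∧ t ≤ 1 ∧ ∃ p ∈ P, ∃ q ∈ Q,
      x = ![(1 - t) * p 0 + t * q 0, (1 - t) * p 1 + t * q 1, t]}) ?_ ?_ hx
  · obtain ⟨p0, hp0⟩ := hPn
    obtain ⟨q0, hq0⟩ := hQn
    rintro _ (⟨p, hp, rfl⟩ | ⟨q, hq, rfl⟩)
    · refine ⟨0, le_rfl, zero_le_one, p, hp, q0, hq0, ?_⟩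
      ext i; fin_cases i
      · simp [Fin.snoc]
      · simp [Fin.snoc]
      · simp [Fin.snoc]
    · refine ⟨1, zero_le_one, le_rfl, p0, hp0, q, hq, ?_⟩
      ext i; fin_cases i
      · simp [Fin.snoc]
      · simp [Fin.snoc]
      · simp [Fin.snoc]
  · rintro _ ⟨t, t0, t1, p, hp, q, hq, rfl⟩ _ ⟨t', t0', t1', p', hp', q', hq', rfl⟩ a b ha hb hab
    have hc0 : 0 ≤ a * t + b * t' := by positivity
    have hc1 : 0 ≤ a * (1 - t) + b * (1 - t') :=
      add_nonneg (mul_nonneg ha (by linarith)) (mul_nonneg hb (by linarith))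
    have key : ∀ (K : Set (Fin 2 → ℝ)), Convex ℝ K → ∀ p ∈ K, ∀ p' ∈ K, ∀ c d : ℝ, 0 ≤ c → 0 ≤ d →
        ∃ r ∈ K, ∀ i, (c + d) * r i = c * p i + d * p' i := by
      intro K hK p hp p' hp' c d hc hd
      rcases eq_or_lt_of_le (add_nonneg hc hd) with h | h
      · refine ⟨p, hp, fun i => ?_⟩
        have : c = 0 := by linarith
        have : d = 0 := by linarith
        subst_vars; simp
      · refine ⟨_, hK hp hp' (a := c / (c + d)) (b := d / (c + d)) (by positivity) (by positivity)
          (by field_simp), fun i => ?_⟩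
        simp; field_simp
    obtain ⟨r, hr, er⟩ := key P hP p hp p' hp' (a * (1 - t)) (b * (1 - t'))
      (mul_nonneg ha (by linarith)) (mul_nonneg hb (by linarith))
    obtain ⟨r', hr', er'⟩ := key Q hQ q hq q' hq' (a * t) (b * t')
      (mul_nonneg ha (by linarith)) (mul_nonneg hb (by linarith))
    refine ⟨a * t + b * t', hc0, by linarith, r, hr, r', hr', ?_⟩
    have e : 1 - (a * t + b * t') = a * (1 - t) + b * (1 - t') := by linarith
    ext i; fin_cases i
    · simp [e]; rw [er 0, er' 0]; ring
    · simp [e]; rw [er 1, er' 1]; ring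
    · simp

lemma cay_lift (P Q : Set (Fin 2 → ℝ)) (hP : Convex ℝ P) (hQ : Convex ℝ Q) (hPn : P.Nonempty)
    (hQn : Q.Nonempty) (x : Fin 3 → ℤ) (hx : toR3 x ∈ cay P Q) :
    ∃ w : Fin 2 → ℤ, (x = lift3 w 0 ∧ toR2 w ∈ P) ∨ (x = lift3 w 1 ∧ toR2 w ∈ Q) := by
  obtain ⟨t, t0, t1, p, hp, q, hq, e⟩ := mem_cay P Q hP hQ hPn hQn _ hx
  have e0 := congrFun e 0
  have e1 := congrFun e 1
  have e2 := congrFun e 2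
  simp [toR3] at e0 e1 e2
  have h0 : 0 ≤ x 2 := by rw [← e2] at t0; exact_mod_cast t0
  have h1 : x 2 ≤ 1 := by rw [← e2] at t1; exact_mod_cast t1
  refine ⟨![x 0, x 1], ?_⟩
  rcases (by omega : x 2 = 0 ∨ x 2 = 1) with h | h
  · left
    rw [h] at e2
    rw [← e2] at e0 e1
    refine ⟨by ext i; fin_cases i <;> simp [lift3, h], ?_⟩
    convert hp using 1
    ext i; fin_cases i
    · simpa [toR2] using e0
    · simpa [toR2] using e1
  · right
    rw [h] at e2
    rw [← e2] at e0 e1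
    refine ⟨by ext i; fin_cases i <;> simp [lift3, h], ?_⟩
    convert hq using 1
    ext i; fin_cases i
    · simpa [toR2] using e0
    · simpa [toR2] using e1

lemma lift_cay0 (P Q : Set (Fin 2 → ℝ)) (w : Fin 2 → ℤ) (h : toR2 w ∈ P) :
    toR3 (lift3 w 0) ∈ cay P Q := by
  apply subset_convexHull
  left
  refine ⟨_, h, ?_⟩
  ext i; fin_cases i <;> simp [toR3, toR2, lift3, Fin.snoc]

lemma lift_cay1 (P Q : Set (Fin 2 → ℝ)) (w : Fin 2 → ℤ) (h : toR2 w ∈ Q) :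
    toR3 (lift3 w 1) ∈ cay P Q := by
  apply subset_convexHull
  right
  refine ⟨_, h, ?_⟩
  ext i; fin_cases i <;> simp [toR3, toR2, lift3, Fin.snoc]


lemma lem31b (K : Set (Fin 3 → ℝ)) (hK : Convex ℝ K) (h h' : ℤ) (hh : h' - h = 1 ∨ h' - h = -1)
    (w0 w1 w2 w3 : Fin 2 → ℤ) (h0 : toR3 (lift3 w0 h) ∈ K) (h1 : toR3 (lift3 w1 h) ∈ K)
    (h2 : toR3 (lift3 w2 h) ∈ K) (h3 : toR3 (lift3 w3 h') ∈ K)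
    (hD : D2 (w1 - w0) (w2 - w0) ≠ 0) (x : Fin 3 → ℝ) (s : Set (Fin 3 → ℝ))
    (hs : s = {toR3 (lift3 w0 h), toR3 (lift3 w1 h), toR3 (lift3 w2 h), toR3 (lift3 w3 h')})
    (hx : x ∈ convexHull ℝ s) : Good K x := by
  subst hs
  exact lem31 K hK h h' hh w3 h3 x (D2 (w1 - w0) (w2 - w0)).natAbs w0 w1 w2 h0 h1 h2 hD
    (by rw [Int.natCast_natAbs]) hx

lemma lem22 (P Q : Set (Fin 2 → ℝ)) (hPQ : IsWeakMinkowskiSummand P Q)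
    (hP : IsLatticePolytope2 P) (hQ : IsLatticePolytope2 Q) (x : Fin 3 → ℝ) (n : ℕ) :
    ∀ (a0 a1 b0 b1 : Fin 2 → ℤ), toR2 a0 ∈ P → toR2 a1 ∈ P → toR2 b0 ∈ Q → toR2 b1 ∈ Q →
    0 < D2 (a1 - a0) (b1 - b0) → D2 (a1 - a0) (b1 - b0) ≤ n →
    x ∈ convexHull ℝ {toR3 (lift3 a0 0), toR3 (lift3 a1 0), toR3 (lift3 b0 1), toR3 (lift3 b1 1)} →
    Good (cay P Q) x := by
  have hK : Convex ℝ (cay P Q) := convex_convexHull ℝ _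
  induction n with
  | zero => intro a0 a1 b0 b1 _ _ _ _ h1 h2; exfalso; push_cast at h2; omega
  | succ n ih =>
    intro a0 a1 b0 b1 h0 h1 k0 k1 hq hn hx
    have H0 := lift_cay0 P Q a0 h0
    have H1 := lift_cay0 P Q a1 h1
    have K0 := lift_cay1 P Q b0 k0
    have K1 := lift_cay1 P Q b1 k1
    push_cast at hn
    by_cases hD : 2 ≤ D2 (a1 - a0) (b1 - b0)
    · have hqR : (0:ℝ) < (D2 (a1 - a0) (b1 - b0) : ℤ) := by exact_mod_cast hq
      rcases claim P Q hPQ hP hQ a0 a1 b0 b1 h0 h1 k0 k1 hD with ⟨c, hc, c0, c1⟩ | ⟨d, hd, d0, d1⟩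
      · have HC := lift_cay0 P Q c hc
        have key := stellar _ _ _ _ (toR3 (lift3 c 0)) x
          (1 - (D2 (c - a0) (b1 - b0) : ℤ) / (D2 (a1 - a0) (b1 - b0) : ℤ))
          ((D2 (c - a0) (b1 - b0) : ℤ) / (D2 (a1 - a0) (b1 - b0) : ℤ))
          (-((D2 (a1 - a0) (c - a0) : ℤ) / (D2 (a1 - a0) (b1 - b0) : ℤ)))
          ((D2 (a1 - a0) (c - a0) : ℤ) / (D2 (a1 - a0) (b1 - b0) : ℤ)) (by ring) (by
            have hne := hqR.ne'
            simp only [toR3_lift3]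
            ext i
            fin_cases i
            · simp
              field_simp
              simp [D2]; ring
            · simp
              field_simp
              simp [D2]; ring
            · simp) hx
        rcases key with ⟨_, h⟩ | ⟨_, h⟩ | ⟨l, h⟩ | ⟨l, h⟩
        · have e : D2 (a1 - c) (b1 - b0) = D2 (a1 - a0) (b1 - b0) - D2 (c - a0) (b1 - b0) := by
            simp [D2]; ring
          exact ih c a1 b0 b1 hc h1 k0 k1 (by omega) (by omega) h
        · exact ih a0 c b0 b1 h0 hc k0 k1 (by omega) (by omega) h
        · refine lem31b _ hK 0 1 (by simp) a0 a1 c b1 H0 H1 HC K1 ?_ x _ rfl h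
          intro e; rw [e] at l; simp at l
        · refine lem31b _ hK 0 1 (by simp) a0 a1 c b0 H0 H1 HC K0 ?_ x _ ?_ h
          · intro e; rw [e] at l; simp at l
          · ext y; simp; tauto
      · have HC := lift_cay1 P Q d hd
        have key := stellar _ _ _ _ (toR3 (lift3 d 1)) x
          (-((D2 (d - b0) (b1 - b0) : ℤ) / (D2 (a1 - a0) (b1 - b0) : ℤ)))
          ((D2 (d - b0) (b1 - b0) : ℤ) / (D2 (a1 - a0) (b1 - b0) : ℤ))
          (1 - ((D2 (a1 - a0) (d - b0) : ℤ) / (D2 (a1 - a0) (b1 - b0) : ℤ)))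
          ((D2 (a1 - a0) (d - b0) : ℤ) / (D2 (a1 - a0) (b1 - b0) : ℤ)) (by ring) (by
            have hne := hqR.ne'
            simp only [toR3_lift3]
            ext i
            fin_cases i
            · simp
              field_simp
              simp [D2]; ring
            · simp
              field_simp
              simp [D2]; ring
            · simp) hx
        have e2 : D2 (b1 - b0) (d - b0) = - D2 (d - b0) (b1 - b0) := by simp [D2]; ring
        rcases key with ⟨l, h⟩ | ⟨l, h⟩ | ⟨_, h⟩ | ⟨_, h⟩
        · refine lem31b _ hK 1 0 (by simp) b0 b1 d a1 K0 K1 HC H1 ?_ x _ ?_ h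
          · intro e; rw [e2, neg_eq_zero] at e; rw [e] at l; simp at l
          · ext y; simp; tauto
        · refine lem31b _ hK 1 0 (by simp) b0 b1 d a0 K0 K1 HC H0 ?_ x _ ?_ h
          · intro e; rw [e2, neg_eq_zero] at e; rw [e] at l; simp at l
          · ext y; simp; tauto
        · have e : D2 (a1 - a0) (b1 - d) = D2 (a1 - a0) (b1 - b0) - D2 (a1 - a0) (d - b0) := by
            simp [D2]; ring
          exact ih a0 a1 d b1 h0 h1 hd k1 (by omega) (by omega) h
        · exact ih a0 a1 b0 d h0 h1 k0 hd (by omega) (by omega) h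
    · have e1 : D2 (a1 - a0) (b1 - b0) = 1 := by omega
      refine good_of_det _ hK _ _ _ _ H0 H1 K0 K1 ?_ x hx
      have hdet : (Matrix.of ![lift3 a1 0 - lift3 a0 0, lift3 b0 1 - lift3 a0 0,
          lift3 b1 1 - lift3 a0 0]).det = - D2 (a1 - a0) (b1 - b0) := by
        simp [Matrix.det_fin_three, lift3, D2]; ring
      rw [hdet, e1]; simp

lemma lem22b (P Q : Set (Fin 2 → ℝ)) (hPQ : IsWeakMinkowskiSummand P Q)
    (hP : IsLatticePolytope2 P) (hQ : IsLatticePolytope2 Q) (x : Fin 3 → ℝ)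
    (a0 a1 b0 b1 : Fin 2 → ℤ) (h0 : toR2 a0 ∈ P) (h1 : toR2 a1 ∈ P) (k0 : toR2 b0 ∈ Q)
    (k1 : toR2 b1 ∈ Q) (hD : D2 (a1 - a0) (b1 - b0) ≠ 0) (s : Set (Fin 3 → ℝ))
    (hs : s = {toR3 (lift3 a0 0), toR3 (lift3 a1 0), toR3 (lift3 b0 1), toR3 (lift3 b1 1)})
    (hx : x ∈ convexHull ℝ s) : Good (cay P Q) x := by
  subst hs
  rcases lt_or_gt_of_ne hD with h | h
  · have e : D2 (a1 - a0) (b0 - b1) = - D2 (a1 - a0) (b1 - b0) := by simp [D2]; ring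
    refine lem22 P Q hPQ hP hQ x (D2 (a1 - a0) (b1 - b0)).natAbs a0 a1 b1 b0 h0 h1 k1 k0
      (by omega) (by omega) ?_
    rwa [Set.pair_comm (toR3 (lift3 b1 1))]
  · exact lem22 P Q hPQ hP hQ x (D2 (a1 - a0) (b1 - b0)).natAbs a0 a1 b0 b1 h0 h1 k0 k1
      (by omega) (by omega) hx

lemma det_ne (p : Fin 4 → Fin 3 → ℤ) (h : AffineIndependent ℝ (fun i => toR3 (p i))) :
    (Matrix.of ![p 1 - p 0, p 2 - p 0, p 3 - p 0]).det ≠ 0 := by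
  intro hd
  rw [← Matrix.exists_vecMul_eq_zero_iff] at hd
  obtain ⟨v, hv, hv0⟩ := hd
  rw [affineIndependent_iff] at h
  have := h Finset.univ ![-((v 0 : ℝ) + v 1 + v 2), v 0, v 1, v 2]
    (by simp [Fin.sum_univ_four]; ring) (by
      ext i
      have := congrFun hv0 i
      simp [Matrix.vecMul, dotProduct, Fin.sum_univ_three] at this
      have : ((v 0 * (p 1 i - p 0 i) + v 1 * (p 2 i - p 0 i) + v 2 * (p 3 i - p 0 i) : ℤ) : ℝ) = 0 := by
        rw [this]; simp
      push_cast at this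
      simp [Fin.sum_univ_four, toR3]
      linear_combination this)
  apply hv
  ext i
  have := this i.succ (by simp)
  fin_cases i <;> simpa using this

lemma main_good (P Q : Set (Fin 2 → ℝ)) (hPQ : IsWeakMinkowskiSummand P Q)
    (hP : IsLatticePolytope2 P) (hQ : IsLatticePolytope2 Q) (p : Fin 4 → Fin 3 → ℤ)
    (h : AffineIndependent ℝ (fun i => toR3 (p i)))
    (hT : convexHull ℝ (Set.range fun i => toR3 (p i)) ⊆ cay P Q) (x : Fin 3 → ℝ)
    (hx : x ∈ convexHull ℝ (Set.range fun i => toR3 (p i))) : Good (cay P Q) x := by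
  have hd := det_ne p h
  have hK : Convex ℝ (cay P Q) := convex_convexHull ℝ _
  have hm : ∀ i, toR3 (p i) ∈ cay P Q := fun i => hT (subset_convexHull ℝ _ ⟨i, rfl⟩)
  have hPc : Convex ℝ P ∧ P.Nonempty := by
    obtain ⟨V, hV, rfl⟩ := hP
    exact ⟨convex_convexHull ℝ _, by simpa using hV⟩
  have hQc : Convex ℝ Q ∧ Q.Nonempty := by
    obtain ⟨V, hV, rfl⟩ := hQ
    exact ⟨convex_convexHull ℝ _, by simpa using hV⟩
  have hr : (Set.range fun i => toR3 (p i)) = {toR3 (p 0), toR3 (p 1), toR3 (p 2), toR3 (p 3)} := by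
    ext y; simp [Fin.exists_fin_succ, eq_comm]
  rw [hr] at hx
  have hl := fun i => cay_lift P Q hPc.1 hQc.1 hPc.2 hQc.2 (p i) (hm i)
  obtain ⟨w0, e0⟩ := hl 0
  obtain ⟨w1, e1⟩ := hl 1
  obtain ⟨w2, e2⟩ := hl 2
  obtain ⟨w3, e3⟩ := hl 3
  have m0 := hm 0
  have m1 := hm 1
  have m2 := hm 2
  have m3 := hm 3
  generalize p 0 = q0 at *
  generalize p 1 = q1 at *
  generalize p 2 = q2 at *
  generalize p 3 = q3 at *
  clear hl hm hr hT h
  rcases e0 with ⟨rfl, r0⟩ | ⟨rfl, r0⟩ <;> rcases e1 with ⟨rfl, r1⟩ | ⟨rfl, r1⟩ <;>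
    rcases e2 with ⟨rfl, r2⟩ | ⟨rfl, r2⟩ <;> rcases e3 with ⟨rfl, r3⟩ | ⟨rfl, r3⟩ <;>
    simp only [Matrix.det_fin_three, lift3, Matrix.of_apply, Matrix.cons_val, Pi.sub_apply, sub_self, sub_zero, zero_sub, mul_zero, zero_mul, mul_one, one_mul, add_zero, zero_add, mul_neg, neg_mul] at hd
  · exact absurd rfl hd
  · refine lem31b _ hK 0 1 (by simp) w0 w1 w2 w3 m0 m1 m2 m3 (fun e => hd ?_) x _ ?_ hx
    · simp only [D2, Pi.sub_apply] at e; linear_combination e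
    · ext y; simp
  · refine lem31b _ hK 0 1 (by simp) w0 w1 w3 w2 m0 m1 m3 m2 (fun e => hd ?_) x _ ?_ hx
    · simp only [D2, Pi.sub_apply] at e; linear_combination -e
    · ext y; simp; tauto
  · refine lem22b P Q hPQ hP hQ x w0 w1 w2 w3 r0 r1 r2 r3 (fun e => hd ?_) _ ?_ hx
    · simp only [D2, Pi.sub_apply] at e; linear_combination -e
    · ext y; simp
  · refine lem31b _ hK 0 1 (by simp) w0 w2 w3 w1 m0 m2 m3 m1 (fun e => hd ?_) x _ ?_ hx
    · simp only [D2, Pi.sub_apply] at e; linear_combination e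
    · ext y; simp; tauto
  · refine lem22b P Q hPQ hP hQ x w0 w2 w1 w3 r0 r2 r1 r3 (fun e => hd ?_) _ ?_ hx
    · simp only [D2, Pi.sub_apply] at e; linear_combination e
    · ext y; simp; tauto
  · refine lem22b P Q hPQ hP hQ x w0 w3 w1 w2 r0 r3 r1 r2 (fun e => hd ?_) _ ?_ hx
    · simp only [D2, Pi.sub_apply] at e; linear_combination -e
    · ext y; simp; tauto
  · refine lem31b _ hK 1 0 (by simp) w1 w2 w3 w0 m1 m2 m3 m0 (fun e => hd ?_) x _ ?_ hx
    · simp only [D2, Pi.sub_apply] at e; linear_combination e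
    · ext y; simp; tauto
  · refine lem31b _ hK 0 1 (by simp) w1 w2 w3 w0 m1 m2 m3 m0 (fun e => hd ?_) x _ ?_ hx
    · simp only [D2, Pi.sub_apply] at e; linear_combination -e
    · ext y; simp; tauto
  · refine lem22b P Q hPQ hP hQ x w1 w2 w0 w3 r1 r2 r0 r3 (fun e => hd ?_) _ ?_ hx
    · simp only [D2, Pi.sub_apply] at e; linear_combination -e
    · ext y; simp; tauto
  · refine lem22b P Q hPQ hP hQ x w1 w3 w0 w2 r1 r3 r0 r2 (fun e => hd ?_) _ ?_ hx
    · simp only [D2, Pi.sub_apply] at e; linear_combination e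
    · ext y; simp; tauto
  · refine lem31b _ hK 1 0 (by simp) w0 w2 w3 w1 m0 m2 m3 m1 (fun e => hd ?_) x _ ?_ hx
    · simp only [D2, Pi.sub_apply] at e; linear_combination -e
    · ext y; simp; tauto
  · refine lem22b P Q hPQ hP hQ x w2 w3 w0 w1 r2 r3 r0 r1 (fun e => hd ?_) _ ?_ hx
    · simp only [D2, Pi.sub_apply] at e; linear_combination -e
    · ext y; simp; tauto
  · refine lem31b _ hK 1 0 (by simp) w0 w1 w3 w2 m0 m1 m3 m2 (fun e => hd ?_) x _ ?_ hx
    · simp only [D2, Pi.sub_apply] at e; linear_combination e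
    · ext y; simp; tauto
  · refine lem31b _ hK 1 0 (by simp) w0 w1 w2 w3 m0 m1 m2 m3 (fun e => hd ?_) x _ ?_ hx
    · simp only [D2, Pi.sub_apply] at e; linear_combination -e
    · ext y; simp
  · exact absurd rfl hd

/-- Let `Q` be a lattice polygon, `P` a lattice polytope which is a weak
Minkowski summand of `Q`, and `T` an empty lattice tetrahedron contained in
`Cay(P,Q)`.  Then `T` can be covered by unimodular tetrahedra contained in
`Cay(P,Q)`. -/
theorem empty_tet_in_cayley_unimodular_cover
    (P Q : Set (Fin 2 → ℝ))
    (hQ : IsLatticePolytope2 Q) (hQdim : affineSpan ℝ Q = ⊤)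
    (hP : IsLatticePolytope2 P)
    (hPQ : IsWeakMinkowskiSummand P Q)
    (p : Fin 4 → Fin 3 → ℤ) (hEmpty : EmptyLatticeTet p)
    (hT : convexHull ℝ (Set.range fun i => toR3 (p i)) ⊆ cay P Q) :
    ∃ 𝒞 : Set (Set (Fin 3 → ℝ)),
      (∀ S ∈ 𝒞, IsUnimodularTet S ∧ S ⊆ cay P Q) ∧
      convexHull ℝ (Set.range fun i => toR3 (p i)) ⊆ ⋃₀ 𝒞 := by
  refine ⟨{S | IsUnimodularTet S ∧ S ⊆ cay P Q}, fun S hS => hS, fun x hx => ?_⟩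
  obtain ⟨S, h1, h2, h3⟩ := main_good P Q hPQ hP hQ p hEmpty.1 hT x hx
  exact ⟨S, ⟨h1, h2⟩, h3⟩
end
end
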